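/- arXiv:2604.02496 — 8 statements merged into one kernel-verified Lean document; each statement's English description precedes it below -/
import Mathlib

section
/- Let x̄ ∈ 𝒳 ∩ ℤ^E be a routing plan and b ∈ ℤ₊^{V₊}. Then conv(Π(x̄) ∩ [0,b]^N) = ∩_{R∈ℛ(x̄)} conv(Π(R) ∩ [0,b]^N). -/
set_option autoImplicit false

open Finset

namespace VRPSD

variable {Vp : Type*} [Fintype Vp] [DecidableEq Vp]
variable {Sc : Type*} [Fintype Sc] [Nonempty Sc]

/-- Position `j` of the closed walk `0, v₁, …, v_ℓ, 0`:
`j = 0` gives the depot (`none`), `1 ≤ j ≤ ℓ` gives customer `v_j`,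
and `j ≥ ℓ + 1` gives the depot again. -/
def nodeAt (L : List Vp) (j : ℕ) : Option Vp :=
  if j = 0 then none else L[j-1]?

/-- Directed flow feasibility (Formulation (1) of the paper) witnessing recourse action `y`
for the directed route given by the list `L = [v₁, …, v_ℓ]`, demand vector `d` and
vehicle capacity `C`. -/
def FlowFeasible (C : ℚ) (d : Vp → ℚ) (L : List Vp) (y : Vp → ℝ) : Prop :=
  ∃ (f : Option Vp → Option Vp → ℝ) (g : Vp → ℝ),
    (∀ a b, 0 ≤ f a b) ∧ (∀ v, 0 ≤ g v) ∧
    (∀ j : Fin L.length,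
      f (nodeAt L j.val) (nodeAt L (j.val + 1)) + (d (L.get j) : ℝ)
        = f (nodeAt L (j.val + 1)) (nodeAt L (j.val + 2)) + g (L.get j)) ∧
    (∀ j : Fin (L.length + 1), f (nodeAt L j.val) (nodeAt L (j.val + 1)) ≤ (C : ℝ)) ∧
    (∀ j : Fin L.length, g (L.get j) ≤ (C : ℝ) * y (L.get j))

/-- `𝒴^ξ(→R)` : the set of recourse actions for the directed route `L` and a fixed scenario
with demand vector `d`: nonnegative integer vectors admitting a feasible flow. -/
def RecourseActions (C : ℚ) (d : Vp → ℚ) (L : List Vp) : Set (Vp → ℝ) :=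
  {y | (∀ v, 0 ≤ y v) ∧ (∀ v, ∃ m : ℤ, y v = (m : ℝ)) ∧ FlowFeasible C d L y}

/-- `Π(R)` : the set of recourse policies for route `L`. -/
def Policies (C : ℚ) (d : Sc → Vp → ℚ) (L : List Vp) : Set (Sc → Vp → ℝ) :=
  {y | ∀ ξ, y ξ ∈ RecourseActions C (d ξ) L}

/-- `[0,b]^N`. -/
def Box (b : Vp → ℤ) : Set (Sc → Vp → ℝ) :=
  {y | ∀ ξ v, 0 ≤ y ξ v ∧ y ξ v ≤ (b v : ℝ)}

/-- `x(δ(v))` for a customer `v`. -/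
noncomputable def degCust (x : Option Vp → Option Vp → ℝ) (v : Vp) : ℝ :=
  ∑ u ∈ univ.filter (fun u => u ≠ some v), x u (some v)

/-- `x(δ(0))`. -/
noncomputable def degDepot (x : Option Vp → Option Vp → ℝ) : ℝ :=
  ∑ u ∈ univ.filter (fun u => u ≠ (none : Option Vp)), x u none

/-- `x(E(S))` for a customer set `S`. -/
noncomputable def inSum (x : Option Vp → Option Vp → ℝ) (S : Finset Vp) : ℝ :=
  (1/2) * ∑ u ∈ S, ∑ v ∈ S.filter (fun v => v ≠ u), x (some u) (some v)

/-- The subtour-elimination polytope `𝒳_sub` (symmetric edge variables). -/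
def Xsub : Set (Option Vp → Option Vp → ℝ) :=
  {x | (∀ u v, x u v = x v u) ∧ (∀ u, x u u = 0) ∧
       (∀ u v, u ≠ v → 0 ≤ x u v ∧ x u v ≤ 2) ∧
       (∀ v : Vp, degCust x v = 2) ∧
       (∀ S : Finset Vp, S.Nonempty → inSum x S ≤ (S.card : ℝ) - 1)}

/-- `k_ξ(S) = ⌈d^ξ(S)/C⌉`. -/
def kxi (C : ℚ) (d : Vp → ℚ) (S : Finset Vp) : ℤ := ⌈(∑ v ∈ S, d v) / C⌉

/-- The CVRP-feasible polytope `𝒳_cvrp`. -/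
def Xcvrp (C : ℚ) (p : Sc → ℚ) (d : Sc → Vp → ℚ) (k : ℕ) :
    Set (Option Vp → Option Vp → ℝ) :=
  Xsub ∩ {x | degDepot x = 2 * (k : ℝ) ∧
    ∀ S : Finset Vp, S.Nonempty →
      inSum x S ≤ (S.card : ℝ) - ((⌈(∑ v ∈ S, ∑ ξ, p ξ * d ξ v) / C⌉ : ℤ) : ℝ)}

/-- A routing plan: a collection of routes whose customer sets partition `V₊`. -/
def IsRoutingPlan (Rs : List (List Vp)) : Prop :=
  (∀ L ∈ Rs, L ≠ [] ∧ L.Nodup) ∧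
  ∀ v : Vp, ∃! i : Fin Rs.length, v ∈ Rs.get i

/-- The incidence vector of the edges of a single route `L` (closed walk through the depot). -/
noncomputable def routeInc (L : List Vp) (u u' : Option Vp) : ℝ :=
  ∑ j ∈ Finset.range (L.length + 1),
    (if (nodeAt L j = u ∧ nodeAt L (j+1) = u') ∨ (nodeAt L j = u' ∧ nodeAt L (j+1) = u)
     then (1 : ℝ) else 0)

/-- The incidence vector `x̄` of a routing plan. -/
noncomputable def planInc (Rs : List (List Vp)) (u u' : Option Vp) : ℝ :=
  (Rs.map (fun L => routeInc L u u')).sum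

/-- The set `FLOW(x̄)`. -/
def FLOW (C : ℚ) (d : Sc → Vp → ℚ) (b : Vp → ℤ) (x : Option Vp → Option Vp → ℝ) :
    Set (Sc → Vp → ℝ) :=
  {y | y ∈ Box b ∧
    ∃ (f : Sc → Option Vp → Option Vp → ℝ) (g : Sc → Vp → ℝ),
      (∀ ξ a c, 0 ≤ f ξ a c) ∧ (∀ ξ v, 0 ≤ g ξ v) ∧
      (∀ ξ (v : Vp),
        (∑ u ∈ univ.filter (fun u => u ≠ some v), f ξ u (some v)) + (d ξ v : ℝ)
          = (∑ u ∈ univ.filter (fun u => u ≠ some v), f ξ (some v) u) + g ξ v) ∧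
      (∀ ξ (u u' : Option Vp), u ≠ u' → f ξ u u' ≤ ((C : ℝ)/2) * x u u') ∧
      (∀ ξ v, g ξ v ≤ (C : ℝ) * y ξ v)}

/-- The set `SRI(x̄)` (on the `y`-variables only). -/
def SRIy (C : ℚ) (d : Sc → Vp → ℚ) (b : Vp → ℤ) (x : Option Vp → Option Vp → ℝ) :
    Set (Sc → Vp → ℝ) :=
  {y | y ∈ Box b ∧ ∀ S : Finset Vp, S.Nonempty → ∀ ξ,
    ((kxi C (d ξ) S : ℝ) + inSum x S - (S.card : ℝ)) ≤ ∑ v ∈ S, y ξ v}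

/-- The recourse cost `Σ_ξ Σ_v p_ξ w_v y^ξ_v`. -/
noncomputable def cost (p : Sc → ℚ) (w : Vp → ℚ) (y : Sc → Vp → ℝ) : ℝ :=
  ∑ ξ, ∑ v, (p ξ : ℝ) * (w v : ℝ) * y ξ v

/-- `ν(α,β)`. -/
noncomputable def nu (C : ℚ) (d : Sc → Vp → ℚ) (b : Vp → ℤ)
    (α : Sc → Finset Vp → ℝ) (β : Sc → Vp → ℝ) : ℝ :=
  (∑ ξ, ∑ S ∈ univ.filter (fun S : Finset Vp => S ≠ ∅),
      α ξ S * ((kxi C (d ξ) S : ℝ) - (S.card : ℝ)))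
  + ∑ ξ, ∑ v, β ξ v * (b v : ℝ)

/-- `φ_v(α,β)` (only meaningful for `v` with `w v > 0`). -/
noncomputable def phiv (p : Sc → ℚ) (w : Vp → ℚ)
    (α : Sc → Finset Vp → ℝ) (β : Sc → Vp → ℝ) (v : Vp) : ℝ :=
  max (Finset.univ.sup' Finset.univ_nonempty
    (fun ξ => (β ξ v + ∑ S ∈ univ.filter (fun S : Finset Vp => v ∈ S), α ξ S)
      / ((p ξ : ℝ) * (w v : ℝ)))) 0

/-- The set `𝒜` of multipliers. -/
def multA (w : Vp → ℚ) (α : Sc → Finset Vp → ℝ) (β : Sc → Vp → ℝ) : Prop :=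
  (∀ ξ (S : Finset Vp), S ≠ ∅ → 0 ≤ α ξ S) ∧ (∀ ξ v, β ξ v ≤ 0) ∧
  (∀ ξ v, w v = 0 →
    β ξ v + (∑ S ∈ univ.filter (fun S : Finset Vp => v ∈ S), α ξ S) ≤ 0)

/-- The set `ŜRI(x̄)` of pairs `(θ, y)`. -/
def SRIhat (C : ℚ) (d : Sc → Vp → ℚ) (p : Sc → ℚ) (w : Vp → ℚ) (b : Vp → ℤ)
    (x : Option Vp → Option Vp → ℝ) : Set ((Vp → ℝ) × (Sc → Vp → ℝ)) :=
  {θy | (∀ v, 0 ≤ θy.1 v) ∧ θy.2 ∈ Box b ∧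
    (∀ S : Finset Vp, S.Nonempty → ∀ ξ,
      ((kxi C (d ξ) S : ℝ) + inSum x S - (S.card : ℝ)) ≤ ∑ v ∈ S, θy.2 ξ v) ∧
    (∀ v, (∑ ξ, (p ξ : ℝ) * (w v : ℝ) * θy.2 ξ v) ≤ θy.1 v)}

/-- The polyhedron `𝒫`. -/
def Pset (X : Set (Option Vp → Option Vp → ℝ)) (C : ℚ) (d : Sc → Vp → ℚ)
    (p : Sc → ℚ) (w : Vp → ℚ) (b : Vp → ℤ) :
    Set ((Option Vp → Option Vp → ℝ) × (Vp → ℝ)) :=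
  {xθ | xθ.1 ∈ X ∧ ∃ y, (xθ.2, y) ∈ SRIhat C d p w b xθ.1}

/-- The set `Γ(x̄, α, β)`. -/
def GammaSet (C : ℚ) (d : Sc → Vp → ℚ) (p : Sc → ℚ) (w : Vp → ℚ) (b : Vp → ℤ)
    (x : Option Vp → Option Vp → ℝ) (α : Sc → Finset Vp → ℝ) (β : Sc → Vp → ℝ) :
    Set ((Vp → ℝ) × (Sc → Vp → ℝ)) :=
  {θy | (∀ v, 0 ≤ θy.1 v) ∧ θy.2 ∈ Box b ∧
    ((∑ ξ, ∑ S ∈ univ.filter (fun S : Finset Vp => S ≠ ∅), α ξ S * inSum x S)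
        + nu C d b α β
      ≤ ∑ ξ, ∑ v, (β ξ v + ∑ S ∈ univ.filter (fun S : Finset Vp => v ∈ S), α ξ S)
          * θy.2 ξ v) ∧
    (∀ v, (∑ ξ, (p ξ : ℝ) * (w v : ℝ) * θy.2 ξ v) ≤ θy.1 v)}

/-- `V₊(H)` for a partial route given as a list of customer sets. -/
def VplusH (Hs : List (Finset Vp)) : Finset Vp := Hs.foldr (· ∪ ·) ∅

/-- `x(E(S,T))` for disjoint customer sets `S`, `T`. -/
noncomputable def crossSum (x : Option Vp → Option Vp → ℝ) (S T : Finset Vp) : ℝ :=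
  ∑ u ∈ S, ∑ v ∈ T, x (some u) (some v)

/-- `x(H)` for a partial route `H`. -/
noncomputable def xH (x : Option Vp → Option Vp → ℝ) (Hs : List (Finset Vp)) : ℝ :=
  (Hs.map (fun S => inSum x S)).sum
    + (List.zipWith (fun S T => crossSum x S T) Hs Hs.tail).sum

/-- The activation function `W_OF(x ; H)`. -/
noncomputable def WOF (x : Option Vp → Option Vp → ℝ) (Hs : List (Finset Vp)) : ℝ :=
  1 + (xH x Hs - ((VplusH Hs).card : ℝ) + 1)
    + ∑ i ∈ ({2, Hs.length - 1} : Finset ℕ) ∩ Finset.Icc 1 Hs.length,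
        (inSum x (Hs.getD (i-1) ∅) - ((Hs.getD (i-1) ∅).card : ℝ) + 1)

/-- A partial route: pairwise disjoint nonempty customer sets,
no two consecutive non-singletons. -/
def IsPartialRoute (Hs : List (Finset Vp)) : Prop :=
  Hs ≠ [] ∧ (∀ S ∈ Hs, S.Nonempty) ∧ Hs.Pairwise Disjoint ∧
  Hs.Chain' (fun S T => S.card = 1 ∨ T.card = 1)

/-- Indices `(i,j)`, `i ≤ j`, of the contiguous sub-tuples of a partial route. -/
def segIdx (Hs : List (Finset Vp)) : Finset (ℕ × ℕ) :=
  (Finset.range Hs.length ×ˢ Finset.range Hs.length).filter fun q => q.1 ≤ q.2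

/-- The customer set `V₊(H')` of the contiguous sub-tuple `H' = (S_i, …, S_j)` (0-based). -/
def seg (Hs : List (Finset Vp)) (i j : ℕ) : Finset Vp :=
  VplusH ((Hs.drop i).take (j + 1 - i))

/-- `cᵀ x` for symmetric edge functions. -/
noncomputable def dotE (c x : Option Vp → Option Vp → ℝ) : ℝ :=
  (1/2) * ∑ u : Option Vp, ∑ v ∈ univ.filter (fun v => v ≠ u), c u v * x u v

end VRPSD

namespace VRPSD

variable {Vp : Type*} [Fintype Vp] [DecidableEq Vp]
variable {Sc : Type*} [Fintype Sc] [Nonempty Sc]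

/-- Lemma 5 of the paper: the convex hull of the box-restricted recourse
policies of a routing plan is the intersection of the route-wise convex hulls. -/
theorem statement_8
    (C : ℚ) (hC : 0 < C) (d : Sc → Vp → ℚ)
    (hd : ∀ ξ v, 0 ≤ d ξ v) (hdC : ∀ ξ v, d ξ v ≤ C)
    (p : Sc → ℚ) (hp : ∀ ξ, 0 ≤ p ξ) (hps : ∑ ξ, p ξ = 1)
    (k : ℕ) (hk : 0 < k)
    (X : Set (Option Vp → Option Vp → ℝ)) (hX : X = Xsub ∨ X = Xcvrp C p d k)
    (b : Vp → ℤ) (hb : ∀ v, 0 ≤ b v)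
    (Rs : List (List Vp)) (hplan : IsRoutingPlan Rs)
    (hmem : planInc Rs ∈ X) :
    convexHull ℝ ((⋂ i : Fin Rs.length, Policies C d (Rs.get i)) ∩ Box b)
      = ⋂ i : Fin Rs.length, convexHull ℝ (Policies C d (Rs.get i) ∩ Box b) := by
  classical
  choose idx hidx huniq using hplan.2
  apply Set.Subset.antisymm
  · refine Set.subset_iInter fun i => convexHull_mono ?_
    rintro y ⟨h1, h2⟩
    exact ⟨Set.mem_iInter.1 h1 i, h2⟩
  · intro y hy
    let Φ : (Fin Rs.length → Sc → Vp → ℝ) →ₗ[ℝ] (Sc → Vp → ℝ) :=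
      { toFun := fun z ξ v => z (idx v) ξ v
        map_add' := fun _ _ => rfl
        map_smul' := fun _ _ => rfl }
    have hsub : Φ '' (Set.univ.pi fun i : Fin Rs.length => Policies C d (Rs.get i) ∩ Box b)
        ⊆ (⋂ i : Fin Rs.length, Policies C d (Rs.get i)) ∩ Box b := by
      rintro _ ⟨z, hz, rfl⟩
      have hz' : ∀ i, z i ∈ Policies C d (Rs.get i) ∩ Box b := fun i => hz i trivial
      refine ⟨Set.mem_iInter.2 fun i ξ => ⟨fun v => ((hz' (idx v)).2 ξ v).1,
        fun v => ((hz' (idx v)).1 ξ).2.1 v, ?_⟩, fun ξ v => (hz' (idx v)).2 ξ v⟩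
      obtain ⟨f, g, h1, h2, h3, h4, h5⟩ := ((hz' i).1 ξ).2.2
      refine ⟨f, g, h1, h2, h3, h4, fun j => ?_⟩
      have hj : i = idx ((Rs.get i).get j) := huniq _ i (List.get_mem _ _)
      have he : Φ z ξ ((Rs.get i).get j) = z i ξ ((Rs.get i).get j) := by
        change z (idx ((Rs.get i).get j)) ξ _ = _
        rw [← hj]
      rw [he]
      exact h5 j
    refine convexHull_mono hsub ?_
    rw [← Φ.image_convexHull, convexHull_pi]
    exact ⟨fun _ => y, fun i _ => Set.mem_iInter.1 hy i, rfl⟩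

end VRPSD
end

section
/- Let Q be a recourse function with disaggregation Q(R,v) satisfying Assumption (disaggregation), and suppose there are w ∈ ℚ₊^{V₊} and b ∈ ℤ₊^{V₊} such that for every route R there exists ȳ_R ∈ Π(R) ∩ [0,b]^N with Q(R,v) ≥ Σ_{ξ∈[N]} p_ξ w_v (ȳ_R)^ξ_v for every v ∈ V₊(R). Then for every (x̄,θ̄) ∈ ℱ(𝒳,Q) there exists y ∈ Π(x̄) ∩ [0,b]^N with θ̄_v ≥ Σ_{ξ∈[N]} p_ξ w_v y^ξ_v for every v ∈ V₊; i.e., ℱ(𝒳,Q) is contained in the projection onto the (x,θ)-variables of the set {(x,θ,y) : x ∈ 𝒳 ∩ ℤ^E, y ∈ Π(x) ∩ [0,b]^N, θ_v ≥ Σ_ξ p_ξ w_v y^ξ_v for all v}. -/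
set_option autoImplicit false

open Finset

namespace VRPSD

variable {Vp : Type*} [Fintype Vp] [DecidableEq Vp]
variable {Sc : Type*} [Fintype Sc] [Nonempty Sc]

/-- Proposition 1 of the paper: if the disaggregated recourse function `Q`
is lower bounded by a recourse policy with weights `w` (Assumption 4), then every point
of `ℱ(𝒳,Q)` lifts to a feasible point of Formulation (3): there exists a recourse policy
`y ∈ Π(x̄) ∩ [0,b]^N` with `θ̄_v ≥ Σ_ξ p_ξ w_v y^ξ_v` for all `v`. -/
theorem statement_9
    (C : ℚ) (hC : 0 < C) (d : Sc → Vp → ℚ)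
    (hd : ∀ ξ v, 0 ≤ d ξ v) (hdC : ∀ ξ v, d ξ v ≤ C)
    (p : Sc → ℚ) (hp : ∀ ξ, 0 ≤ p ξ) (hps : ∑ ξ, p ξ = 1)
    (k : ℕ) (hk : 0 < k)
    (X : Set (Option Vp → Option Vp → ℝ)) (hX : X = Xsub ∨ X = Xcvrp C p d k)
    (w : Vp → ℚ) (hw : ∀ v, 0 ≤ w v) (b : Vp → ℤ) (hb : ∀ v, 0 ≤ b v)
    (Q : List Vp → Vp → ℝ)
    (hQzero : ∀ (L : List Vp) (v : Vp), v ∉ L → Q L v = 0)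
    (hQnn : ∀ L : List Vp, L ≠ [] → L.Nodup → 0 ≤ ∑ v, Q L v)
    (hlb : ∀ L : List Vp, L ≠ [] → L.Nodup →
      ∃ y ∈ Policies C d L ∩ Box b,
        ∀ v ∈ L, (∑ ξ, (p ξ : ℝ) * (w v : ℝ) * y ξ v) ≤ Q L v)
    (Rs : List (List Vp)) (hplan : IsRoutingPlan Rs) (hmem : planInc Rs ∈ X)
    (θ : Vp → ℝ) (hθ : ∀ v, 0 ≤ θ v)
    (hF : ∀ v, (∑ i : Fin Rs.length, Q (Rs.get i) v) ≤ θ v) :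
    ∃ y ∈ (⋂ i : Fin Rs.length, Policies C d (Rs.get i)) ∩ Box b,
      ∀ v, (∑ ξ, (p ξ : ℝ) * (w v : ℝ) * y ξ v) ≤ θ v := by
  have h1 : ∀ i : Fin Rs.length, ∃ y ∈ Policies C d (Rs.get i) ∩ Box b,
      ∀ v ∈ Rs.get i, (∑ ξ, (p ξ : ℝ) * (w v : ℝ) * y ξ v) ≤ Q (Rs.get i) v := fun i =>
    hlb _ (hplan.1 _ (List.get_mem Rs i)).1 (hplan.1 _ (List.get_mem Rs i)).2
  choose Y hY hYQ using h1
  choose r hr hru using hplan.2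
  refine ⟨fun ξ v => Y (r v) ξ v, ⟨?_, ?_⟩, ?_⟩
  · refine Set.mem_iInter.2 fun i ξ => ⟨?_, ?_, ?_⟩
    · intro v
      exact ((hY (r v)).1 ξ).1 v
    · intro v
      exact ((hY (r v)).1 ξ).2.1 v
    · obtain ⟨f, g, hf, hg, h3, h4, h5⟩ := ((hY i).1 ξ).2.2
      refine ⟨f, g, hf, hg, h3, h4, fun j => ?_⟩
      have : i = r ((Rs.get i).get j) := hru _ i (List.get_mem _ _)
      have h6 := h5 j
      show _ ≤ (C : ℝ) * Y (r ((Rs.get i).get j)) ξ ((Rs.get i).get j)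
      rw [← this]
      exact h6
  · intro ξ v
    exact (hY (r v)).2 ξ v
  · intro v
    refine (hYQ (r v) v (hr v)).trans (le_trans (le_of_eq ?_) (hF v))
    symm
    apply Finset.sum_eq_single (r v)
    · intro i _ hi
      exact hQzero _ _ fun hv => hi (hru v i hv)
    · intro h
      exact absurd (Finset.mem_univ _) h

end VRPSD
end

section
/- Suppose the disaggregation of the scenario-optimal recourse function Q* satisfies: for every route R there exists a scenario-optimal recourse policy y* ∈ Π(R) ∩ [0,b]^N attaining Q*(R) such that Q*(R,v) = Σ_{ξ∈[N]} p_ξ w_v (y*)^ξ_v for every v ∈ V₊. Then for every route R and every subroute R' ⊆ R, Σ_{v∈V₊(R')} Q*(R',v) ≤ Σ_{v∈V₊(R')} Q*(R,v). -/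
set_option autoImplicit false

open Finset

namespace VRPSD

variable {Vp : Type*} [Fintype Vp] [DecidableEq Vp]
variable {Sc : Type*} [Fintype Sc] [Nonempty Sc]

lemma nodeAt_left (s L' t : List Vp) (j : ℕ) (hj : j ≤ L'.length) :
    (nodeAt L' j).elim (nodeAt (s ++ L' ++ t) s.length) some
      = nodeAt (s ++ L' ++ t) (s.length + j) := by
  rcases j with _ | j
  · simp [nodeAt]
  · have h1 : j < L'.length := by omega
    have h2 : s.length + (j + 1) - 1 = s.length + j := by omega
    simp only [nodeAt, h2]
    simp [h1, List.getElem?_append]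

lemma nodeAt_right (s L' t : List Vp) (j : ℕ) (hj : j ≤ L'.length) :
    (nodeAt L' (j + 1)).elim (nodeAt (s ++ L' ++ t) (s.length + L'.length + 1)) some
      = nodeAt (s ++ L' ++ t) (s.length + j + 1) := by
  rcases hj.lt_or_eq with h | h
  · have := nodeAt_left s L' t (j + 1) h
    rw [← add_assoc] at this
    rw [← this]
    simp [nodeAt, h]
  · subst h
    simp [nodeAt]

lemma flow_restrict (C : ℚ) (d : Vp → ℚ) (s L' t : List Vp) (y y' : Vp → ℝ)
    (hy : ∀ v ∈ L', y' v = y v) (h : FlowFeasible C d (s ++ L' ++ t) y) :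
    FlowFeasible C d L' y' := by
  obtain ⟨f, g, hf, hg, h1, h2, h3⟩ := h
  have key : ∀ j, j ≤ L'.length →
      f ((nodeAt L' j).elim (nodeAt (s ++ L' ++ t) s.length) some)
        ((nodeAt L' (j + 1)).elim (nodeAt (s ++ L' ++ t) (s.length + L'.length + 1)) some)
      = f (nodeAt (s ++ L' ++ t) (s.length + j)) (nodeAt (s ++ L' ++ t) (s.length + j + 1)) := by
    intro j hj
    rw [nodeAt_left s L' t j hj, nodeAt_right s L' t j hj]
  have hlen : ∀ j, j < L'.length → s.length + j < (s ++ L' ++ t).length := by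
    intro j hj
    simp only [List.length_append]
    omega
  have hget : ∀ j (hj : j < L'.length), (s ++ L' ++ t).get ⟨s.length + j, hlen j hj⟩
      = L'.get ⟨j, hj⟩ := by
    intro j hj
    simp [List.getElem_append, hj]
  refine ⟨fun a c => f (a.elim (nodeAt (s ++ L' ++ t) s.length) some)
    (c.elim (nodeAt (s ++ L' ++ t) (s.length + L'.length + 1)) some), g,
    fun _ _ => hf _ _, hg, ?_, ?_, ?_⟩
  · rintro ⟨j, hj⟩
    have := h1 ⟨s.length + j, hlen j hj⟩
    rw [hget j hj] at this
    have k2 := key (j + 1) hj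
    simp only [← add_assoc] at k2
    simp only [key j hj.le]
    rw [k2]
    exact this
  · rintro ⟨j, hj⟩
    have := h2 ⟨s.length + j, by simp only [List.length_append]; omega⟩
    simp only [key j (by omega)]
    exact this
  · rintro ⟨j, hj⟩
    have := h3 ⟨s.length + j, hlen j hj⟩
    rw [hget j hj] at this
    rw [hy _ (List.get_mem _ _)]
    exact this

/-- Corollary 3 of the paper: if the disaggregation of the scenario-optimal
recourse function is given by optimal policies, then it is monotone under subroutes. -/
theorem statement_10
    (C : ℚ) (hC : 0 < C) (d : Sc → Vp → ℚ)
    (hd : ∀ ξ v, 0 ≤ d ξ v) (hdC : ∀ ξ v, d ξ v ≤ C)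
    (p : Sc → ℚ) (hp : ∀ ξ, 0 ≤ p ξ) (hps : ∑ ξ, p ξ = 1)
    (w : Vp → ℚ) (hw : ∀ v, 0 ≤ w v) (b : Vp → ℤ) (hb : ∀ v, 0 ≤ b v)
    (hne : ∀ L : List Vp, L ≠ [] → L.Nodup → (Policies C d L ∩ Box b).Nonempty)
    (Qs : List Vp → Vp → ℝ)
    (hQzero : ∀ (L : List Vp) (v : Vp), v ∉ L → Qs L v = 0)
    (hdis : ∀ L : List Vp, L ≠ [] → L.Nodup →
      ∃ y ∈ Policies C d L ∩ Box b,
        (∀ y' ∈ Policies C d L ∩ Box b, cost p w y ≤ cost p w y') ∧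
        (∀ v, Qs L v = ∑ ξ, (p ξ : ℝ) * (w v : ℝ) * y ξ v))
    (L L' : List Vp) (hL : L ≠ []) (hnd : L.Nodup)
    (hL' : L' ≠ []) (hinf : L' <:+: L) :
    (L'.map (fun v => Qs L' v)).sum ≤ (L'.map (fun v => Qs L v)).sum := by
  obtain ⟨s, t, rfl⟩ := hinf
  have hnd' : L'.Nodup := (List.nodup_append.1 (List.nodup_append.1 hnd).1).2.1
  obtain ⟨y, ⟨hyP, hyB⟩, -, hyQ⟩ := hdis _ hL hnd
  obtain ⟨z, -, hzopt, hzQ⟩ := hdis L' hL' hnd'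
  have hmem : (fun ξ v => if v ∈ L' then y ξ v else 0) ∈ Policies C d L' ∩ Box b := by
    refine ⟨fun ξ => ⟨fun v => ?_, fun v => ?_, ?_⟩, fun ξ v => ?_⟩
    · dsimp only
      split_ifs
      · exact (hyP ξ).1 v
      · exact le_rfl
    · dsimp only
      split_ifs
      · exact (hyP ξ).2.1 v
      · exact ⟨0, by simp⟩
    · exact flow_restrict C (d ξ) s L' t (y ξ) _ (fun v hv => by simp [hv]) (hyP ξ).2.2
    · dsimp only
      split_ifs
      · exact hyB ξ v
      · exact ⟨le_rfl, by exact_mod_cast hb v⟩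
  have hle := hzopt _ hmem
  have e1 : (L'.map (fun v => Qs L' v)).sum = cost p w z := by
    rw [← List.sum_toFinset _ hnd', cost, Finset.sum_comm]
    rw [Finset.sum_subset (Finset.subset_univ _)
      (fun v _ hv => hQzero L' v (by simpa using hv))]
    exact Finset.sum_congr rfl fun v _ => hzQ v
  have e2 : (L'.map (fun v => Qs (s ++ L' ++ t) v)).sum
      = cost p w (fun ξ v => if v ∈ L' then y ξ v else 0) := by
    rw [← List.sum_toFinset _ hnd', cost, Finset.sum_comm]
    rw [← Finset.sum_subset (Finset.subset_univ L'.toFinset)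
      (fun v _ hv => Finset.sum_eq_zero fun ξ _ => by
        have : v ∉ L' := by simpa using hv
        simp [this])]
    refine Finset.sum_congr rfl fun v hv => ?_
    have : v ∈ L' := by simpa using hv
    rw [hyQ]
    simp [this]
  rw [e1, e2]
  exact hle

end VRPSD
end

section
/- Let a¹,…,a^N ∈ ℝ^{V₊}, h ∈ ℝ, and consider ℋ := {(θ,y) ∈ ℝ₊^{V₊} × ℝ₊^{[N]×V₊} : Σ_{ξ∈[N]} (a^ξ)ᵀ y^ξ ≥ h, and θ_v ≥ Σ_{ξ∈[N]} p_ξ w_v y^ξ_v for all v ∈ V₊}. Then: (i) if there exist v ∈ V₊ and ξ ∈ [N] with w_v = 0 and a^ξ_v > 0, then proj_θ(ℋ) = ℝ₊^{V₊}; (ii) otherwise, proj_θ(ℋ) = {θ ∈ ℝ₊^{V₊} : Σ_{v∈V₊ : w_v>0} (max_{ξ∈[N]} { a^ξ_v / (p_ξ w_v) })⁺ · θ_v ≥ h}. -/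
set_option autoImplicit false

open Finset

namespace VRPSD

variable {Vp : Type*} [Fintype Vp] [DecidableEq Vp] [Nonempty Vp]
variable {Sc : Type*} [Fintype Sc] [Nonempty Sc]

/-- Lemma 6 of the paper: projection of a single linear inequality on the
`y`-variables onto the `θ`-space. -/
theorem statement_11
    (p : Sc → ℚ) (hp : ∀ ξ, 0 < p ξ)
    (w : Vp → ℚ) (hw : ∀ v, 0 ≤ w v)
    (a : Sc → Vp → ℝ) (h : ℝ) :
    ((∃ (v : Vp) (ξ : Sc), w v = 0 ∧ 0 < a ξ v) →
      {θ : Vp → ℝ | ∃ y : Sc → Vp → ℝ,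
          (∀ v, 0 ≤ θ v) ∧ (∀ ξ v, 0 ≤ y ξ v) ∧
          (h ≤ ∑ ξ, ∑ v, a ξ v * y ξ v) ∧
          (∀ v, (∑ ξ, (p ξ : ℝ) * (w v : ℝ) * y ξ v) ≤ θ v)}
        = {θ : Vp → ℝ | ∀ v, 0 ≤ θ v}) ∧
    ((¬ ∃ (v : Vp) (ξ : Sc), w v = 0 ∧ 0 < a ξ v) →
      {θ : Vp → ℝ | ∃ y : Sc → Vp → ℝ,
          (∀ v, 0 ≤ θ v) ∧ (∀ ξ v, 0 ≤ y ξ v) ∧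
          (h ≤ ∑ ξ, ∑ v, a ξ v * y ξ v) ∧
          (∀ v, (∑ ξ, (p ξ : ℝ) * (w v : ℝ) * y ξ v) ≤ θ v)}
        = {θ : Vp → ℝ | (∀ v, 0 ≤ θ v) ∧
            h ≤ ∑ v ∈ univ.filter (fun v => 0 < w v),
              (max (Finset.univ.sup' Finset.univ_nonempty
                  (fun ξ => a ξ v / ((p ξ : ℝ) * (w v : ℝ)))) 0) * θ v}) := by
  classical
  constructor
  · rintro ⟨v, ξ, hwv, ha⟩
    ext θ
    simp only [Set.mem_setOf_eq]
    constructor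
    · rintro ⟨y, h1, -⟩
      exact h1
    · intro h1
      refine ⟨fun ξ' v' => if ξ' = ξ then (if v' = v then max h 0 / a ξ v else 0) else 0,
        h1, ?_, ?_, ?_⟩
      · intro ξ' v'
        dsimp only
        split_ifs
        · positivity
        · exact le_rfl
        · exact le_rfl
      · rw [Finset.sum_eq_single ξ, Finset.sum_eq_single v]
        · simp only [if_true]
          rw [mul_div_cancel₀ _ ha.ne']
          exact le_max_left _ _
        · intro b _ hb
          simp [hb]
        · simp
        · intro b _ hb
          simp [hb]
        · simp
      · intro v'
        refine le_trans (le_of_eq ?_) (h1 v')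
        apply Finset.sum_eq_zero
        intro ξ' _
        by_cases hv : v' = v
        · subst hv
          simp [hwv]
        · simp [hv]
  · intro hno
    have hno' : ∀ v ξ, w v = 0 → a ξ v ≤ 0 := by
      intro v ξ h0
      by_contra hc
      exact hno ⟨v, ξ, h0, not_le.mp hc⟩
    have hpR : ∀ ξ, (0 : ℝ) < (p ξ : ℝ) := fun ξ => by exact_mod_cast hp ξ
    ext θ
    simp only [Set.mem_setOf_eq]
    constructor
    · rintro ⟨y, h1, h2, h3, h4⟩
      refine ⟨h1, h3.trans ?_⟩
      rw [Finset.sum_comm, Finset.sum_filter]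
      apply Finset.sum_le_sum
      intro v _
      split_ifs with hv
      · have hvR : (0 : ℝ) < (w v : ℝ) := by exact_mod_cast hv
        set M := max (Finset.univ.sup' Finset.univ_nonempty
                  (fun ξ => a ξ v / ((p ξ : ℝ) * (w v : ℝ)))) 0 with hM
        have hM0 : 0 ≤ M := le_max_right _ _
        refine le_trans ?_ (mul_le_mul_of_nonneg_left (h4 v) hM0)
        rw [Finset.mul_sum]
        apply Finset.sum_le_sum
        intro ξ _
        have hpw : 0 < (p ξ : ℝ) * (w v : ℝ) := mul_pos (hpR ξ) hvR
        have hle : a ξ v / ((p ξ : ℝ) * (w v : ℝ)) ≤ M :=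
          (Finset.le_sup' (fun ξ => a ξ v / ((p ξ : ℝ) * (w v : ℝ)))
            (Finset.mem_univ ξ)).trans (le_max_left _ _)
        rw [div_le_iff₀ hpw] at hle
        calc a ξ v * y ξ v ≤ (M * ((p ξ : ℝ) * (w v : ℝ))) * y ξ v :=
              mul_le_mul_of_nonneg_right hle (h2 ξ v)
          _ = _ := by ring
      · have h0 : w v = 0 := le_antisymm (not_lt.mp hv) (hw v)
        apply Finset.sum_nonpos
        intro ξ _
        exact mul_nonpos_of_nonpos_of_nonneg (hno' v ξ h0) (h2 ξ v)
    · rintro ⟨h1, h2⟩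
      have hex : ∀ v, ∃ ξ, Finset.univ.sup' Finset.univ_nonempty
                  (fun ξ => a ξ v / ((p ξ : ℝ) * (w v : ℝ)))
                  = a ξ v / ((p ξ : ℝ) * (w v : ℝ)) := by
        intro v
        obtain ⟨ξ, _, hξ⟩ := Finset.exists_mem_eq_sup' (Finset.univ_nonempty (α := Sc))
          (fun ξ => a ξ v / ((p ξ : ℝ) * (w v : ℝ)))
        exact ⟨ξ, hξ⟩
      choose m hm using hex
      refine ⟨fun ξ v => if ξ = m v then (if 0 < w v ∧ 0 ≤ a ξ v then
        θ v / ((p ξ : ℝ) * (w v : ℝ)) else 0) else 0, h1, ?_, ?_, ?_⟩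
      · intro ξ v
        dsimp only
        split_ifs with hx hy
        · have hvR : (0 : ℝ) < (w v : ℝ) := by exact_mod_cast hy.1
          exact div_nonneg (h1 v) (mul_pos (hpR ξ) hvR).le
        · exact le_rfl
        · exact le_rfl
      · refine h2.trans ?_
        rw [Finset.sum_comm, Finset.sum_filter]
        apply Finset.sum_le_sum
        intro v _
        rw [Finset.sum_eq_single (m v) (by intro b _ hb; simp [hb]) (by simp), hm v]
        simp only [if_true]
        by_cases hv : 0 < w v
        · have hvR : (0 : ℝ) < (w v : ℝ) := by exact_mod_cast hv
          have hpw : 0 < (p (m v) : ℝ) * (w v : ℝ) := mul_pos (hpR _) hvR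
          by_cases ha : 0 ≤ a (m v) v
          · rw [if_pos hv, if_pos ⟨hv, ha⟩, max_eq_left (div_nonneg ha hpw.le)]
            apply le_of_eq
            ring
          · rw [if_pos hv, if_neg (fun hc => ha hc.2),
              max_eq_right (div_nonpos_of_nonpos_of_nonneg (not_le.mp ha).le hpw.le)]
            simp
        · rw [if_neg hv, if_neg (fun hc => hv hc.1)]
          simp
      · intro v
        rw [Finset.sum_eq_single (m v) (by intro b _ hb; simp [hb]) (by simp)]
        simp only [if_true]
        split_ifs with hy
        · have hvR : (0 : ℝ) < (w v : ℝ) := by exact_mod_cast hy.1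
          rw [mul_div_cancel₀ _ (mul_pos (hpR (m v)) hvR).ne']
        · simpa using h1 v

end VRPSD
end

section
/- For every x̄ ∈ 𝒳, proj_θ(ŜRI(x̄)) = {θ ∈ ℝ₊^{V₊} : Σ_{v∈V₊ : w_v>0} φ_v(α,β)·θ_v ≥ Σ_{ξ∈[N]} Σ_{∅⊊S⊆V₊} α^ξ_S·x̄(E(S)) + ν(α,β) for every (α,β) ∈ 𝒜}. Consequently, 𝒫 = {(x,θ) ∈ 𝒳 × ℝ₊^{V₊} : Σ_{v∈V₊ : w_v>0} φ_v(α,β)·θ_v ≥ Σ_ξ Σ_S α^ξ_S·x(E(S)) + ν(α,β) for every (α,β) ∈ 𝒜}. -/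
set_option autoImplicit false

open Finset

namespace VRPSD

variable {Vp : Type*} [Fintype Vp] [DecidableEq Vp]
variable {Sc : Type*} [Fintype Sc] [Nonempty Sc]

theorem farkas_aux {E I : Type*} [AddCommGroup E] [Module ℝ E] [TopologicalSpace E] [Fintype I]
    [DecidableEq I]
    (K : Set E) (hK : IsCompact K) (hKc : Convex ℝ K) (g : E → I → ℝ) (hg : Continuous g)
    (hga : ∀ y z (s t : ℝ), s + t = 1 → g (s • y + t • z) = s • g y + t • g z)
    (h : ∀ y ∈ K, ¬ ∀ i, g y i ≤ 0) :
    ∃ l : I → ℝ, (∀ i, 0 ≤ l i) ∧ ∀ y ∈ K, 0 < ∑ i, l i * g y i := by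
  have hc : Convex ℝ (g '' K) := by
    rintro _ ⟨y, hy, rfl⟩ _ ⟨z, hz, rfl⟩ s t hs ht hst
    exact ⟨s • y + t • z, hKc hy hz hs ht hst, hga y z s t hst⟩
  have hdisj : Disjoint (g '' K) (Set.Iic (0 : I → ℝ)) := by
    rw [Set.disjoint_left]
    rintro _ ⟨y, hy, rfl⟩ hz
    exact h y hy hz
  obtain ⟨f, u, v, h1, huv, h2⟩ := geometric_hahn_banach_compact_closed hc (hK.image hg)
    (convex_Iic (0 : I → ℝ)) isClosed_Iic hdisj
  have hv : v < 0 := by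
    have := h2 0 (by simp)
    simpa using this
  have hf : ∀ z : I → ℝ, f z = ∑ i, f (Pi.single i 1) * z i := by
    intro z
    conv_lhs => rw [pi_eq_sum_univ' z]
    rw [map_sum]
    refine Finset.sum_congr rfl fun i _ => ?_
    rw [map_smul, smul_eq_mul, mul_comm]
  refine ⟨fun i => - f (Pi.single i 1), ?_, ?_⟩
  · intro i
    by_contra hcon
    push Not at hcon
    have hpos : 0 < f (Pi.single i 1) := by linarith
    have := h2 ((v / f (Pi.single i 1)) • (Pi.single i 1)) (by
      intro j
      have : v / f (Pi.single i 1) ≤ 0 := div_nonpos_of_nonpos_of_nonneg hv.le hpos.le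
      by_cases hj : j = i
      · subst hj; simpa using this
      · simp [hj])
    rw [map_smul, smul_eq_mul, div_mul_cancel₀ _ hpos.ne'] at this
    exact lt_irrefl _ this
  · intro y hy
    have := h1 _ ⟨y, hy, rfl⟩
    rw [hf] at this
    simp only [neg_mul, Finset.sum_neg_distrib]
    linarith

theorem swap_aux (a : Finset Vp → ℝ) (y : Vp → ℝ) :
    ∑ S ∈ univ.filter (fun S : Finset Vp => S ≠ ∅), a S * ∑ v ∈ S, y v
      = ∑ v, (∑ S ∈ univ.filter (fun S : Finset Vp => v ∈ S), a S) * y v := by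
  have h1 : ∑ S ∈ univ.filter (fun S : Finset Vp => S ≠ ∅), a S * ∑ v ∈ S, y v
      = ∑ S : Finset Vp, a S * ∑ v ∈ S, y v := by
    rw [Finset.sum_filter]
    refine Finset.sum_congr rfl fun S _ => ?_
    by_cases hS : S = ∅ <;> simp [hS]
  rw [h1]
  have h2 : ∀ S : Finset Vp, a S * ∑ v ∈ S, y v = ∑ v, if v ∈ S then a S * y v else 0 := by
    intro S
    rw [Finset.mul_sum, ← Finset.sum_filter]
    simp
  simp_rw [h2]
  rw [Finset.sum_comm]
  refine Finset.sum_congr rfl fun v _ => ?_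
  rw [Finset.sum_mul, Finset.sum_filter]

theorem proj_forward (C : ℚ) (d : Sc → Vp → ℚ) (p : Sc → ℚ) (hp : ∀ ξ, 0 < p ξ)
    (w : Vp → ℚ) (hw : ∀ v, 0 ≤ w v) (b : Vp → ℤ)
    (x : Option Vp → Option Vp → ℝ) (θ : Vp → ℝ) (y : Sc → Vp → ℝ)
    (hy : (θ, y) ∈ SRIhat C d p w b x)
    (α : Sc → Finset Vp → ℝ) (β : Sc → Vp → ℝ) (hA : multA w α β) :
    (∑ ξ, ∑ S ∈ univ.filter (fun S : Finset Vp => S ≠ ∅), α ξ S * inSum x S)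
                  + nu C d b α β
                ≤ ∑ v ∈ univ.filter (fun v => 0 < w v), phiv p w α β v * θ v := by
  obtain ⟨hθ, hbox, hS, hcost⟩ := hy
  obtain ⟨hα, hβ, hA0⟩ := hA
  simp only at hθ hbox hS hcost
  have s1 : (∑ ξ, ∑ S ∈ univ.filter (fun S : Finset Vp => S ≠ ∅), α ξ S * inSum x S)
                  + nu C d b α β ≤
      ∑ ξ, ∑ v, (β ξ v + ∑ S ∈ univ.filter (fun S : Finset Vp => v ∈ S), α ξ S) * y ξ v := by
    unfold nu
    rw [← add_assoc, ← Finset.sum_add_distrib, ← Finset.sum_add_distrib]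
    refine Finset.sum_le_sum fun ξ _ => ?_
    simp only [add_mul, Finset.sum_add_distrib]
    rw [← swap_aux, ← Finset.sum_add_distrib, add_comm]
    refine add_le_add ?_ ?_
    · exact Finset.sum_le_sum fun v _ => mul_le_mul_of_nonpos_left (hbox ξ v).2 (hβ ξ v)
    · refine Finset.sum_le_sum fun S hSm => ?_
      have hne : S ≠ ∅ := by simpa using hSm
      have := mul_le_mul_of_nonneg_left (hS S (Finset.nonempty_iff_ne_empty.2 hne) ξ) (hα ξ S hne)
      linarith
  refine s1.trans ?_
  rw [Finset.sum_comm, Finset.sum_filter]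
  refine Finset.sum_le_sum fun v _ => ?_
  split_ifs with hv
  · have hφ0 : 0 ≤ phiv p w α β v := le_max_right _ _
    refine le_trans ?_ (mul_le_mul_of_nonneg_left (hcost v) hφ0)
    rw [Finset.mul_sum]
    refine Finset.sum_le_sum fun ξ _ => ?_
    rw [← mul_assoc]
    refine mul_le_mul_of_nonneg_right ?_ (hbox ξ v).1
    have hpw : (0 : ℝ) < (p ξ : ℝ) * (w v : ℝ) := by
      have := hp ξ
      positivity
    rw [← div_le_iff₀ hpw]
    exact le_trans (Finset.le_sup' (fun ξ => (β ξ v + ∑ S ∈ univ.filter (fun S : Finset Vp => v ∈ S), α ξ S)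
      / ((p ξ : ℝ) * (w v : ℝ))) (Finset.mem_univ ξ)) (le_max_left _ _)
  · have hw0 : w v = 0 := le_antisymm (not_lt.1 hv) (hw v)
    exact Finset.sum_nonpos fun ξ _ =>
      mul_nonpos_of_nonpos_of_nonneg (hA0 ξ v hw0) (hbox ξ v).1

theorem proj_backward (C : ℚ) (d : Sc → Vp → ℚ) (p : Sc → ℚ) (hp : ∀ ξ, 0 < p ξ)
    (w : Vp → ℚ) (hw : ∀ v, 0 ≤ w v) (b : Vp → ℤ) (hb : ∀ v, 0 ≤ b v)
    (x : Option Vp → Option Vp → ℝ) (θ : Vp → ℝ) (hθ : ∀ v, 0 ≤ θ v)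
    (H : ∀ (α : Sc → Finset Vp → ℝ) (β : Sc → Vp → ℝ), multA w α β →
    (∑ ξ, ∑ S ∈ univ.filter (fun S : Finset Vp => S ≠ ∅), α ξ S * inSum x S)
                  + nu C d b α β
                ≤ ∑ v ∈ univ.filter (fun v => 0 < w v), phiv p w α β v * θ v) :
    ∃ y, (θ, y) ∈ SRIhat C d p w b x := by
  classical
  by_contra hno
  let g : (Sc → Vp → ℝ) → ((Sc × Finset Vp) ⊕ Vp) → ℝ := fun y i =>
    Sum.elim (fun q : Sc × Finset Vp => if q.2 = ∅ then (0:ℝ) else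
        ((kxi C (d q.1) q.2 : ℝ) + inSum x q.2 - (q.2.card : ℝ)) - ∑ v ∈ q.2, y q.1 v)
      (fun v => (∑ ξ, (p ξ : ℝ) * (w v : ℝ) * y ξ v) - θ v) i
  have hg : Continuous g := by
    refine continuous_pi fun i => ?_
    rcases i with ⟨ξ, S⟩ | v
    · by_cases hS : S = ∅
      · simp only [g, Sum.elim_inl, hS, if_true]; fun_prop
      · simp only [g, Sum.elim_inl, hS, if_false]; fun_prop
    · simp only [g, Sum.elim_inr]; fun_prop
  have hga : ∀ y z (s t : ℝ), s + t = 1 → g (s • y + t • z) = s • g y + t • g z := by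
    intro y z s t hst
    have ht : t = 1 - s := by linarith
    subst ht
    funext i
    rcases i with ⟨ξ, S⟩ | v
    · by_cases hS : S = ∅
      · simp [g, hS]
      · simp only [g, Sum.elim_inl, hS, if_false, Pi.add_apply, Pi.smul_apply, smul_eq_mul,
          Finset.sum_add_distrib, ← Finset.mul_sum]
        ring
    · have e : ∑ ξ, (p ξ : ℝ) * (w v : ℝ) * (s * y ξ v + (1 - s) * z ξ v)
          = s * ∑ ξ, (p ξ : ℝ) * (w v : ℝ) * y ξ v
            + (1 - s) * ∑ ξ, (p ξ : ℝ) * (w v : ℝ) * z ξ v := by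
        rw [Finset.mul_sum, Finset.mul_sum, ← Finset.sum_add_distrib]
        exact Finset.sum_congr rfl fun ξ _ => by ring
      simp only [g, Sum.elim_inr, Pi.add_apply, Pi.smul_apply, smul_eq_mul, e]
      ring
  obtain ⟨l, hl0, hl⟩ := farkas_aux (Set.Icc (0 : Sc → Vp → ℝ) (fun _ v => (b v : ℝ)))
    isCompact_Icc (convex_Icc _ _) g hg hga (by
      intro y hy hcon
      refine hno ⟨y, hθ, fun ξ v => ⟨hy.1 ξ v, hy.2 ξ v⟩, ?_, ?_⟩
      · intro S hS ξ
        have := hcon (Sum.inl (ξ, S))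
        simp only [g, Sum.elim_inl, hS.ne_empty, if_false] at this
        exact sub_nonpos.1 this
      · intro v
        have := hcon (Sum.inr v)
        simp only [g, Sum.elim_inr] at this
        exact sub_nonpos.1 this)
  let α : Sc → Finset Vp → ℝ := fun ξ S => l (Sum.inl (ξ, S))
  let μ : Vp → ℝ := fun v => l (Sum.inr v)
  let A : Sc → Vp → ℝ := fun ξ v => ∑ S ∈ univ.filter (fun S : Finset Vp => v ∈ S), α ξ S
  let c : Sc → Vp → ℝ := fun ξ v => (p ξ : ℝ) * (w v : ℝ) * μ v - A ξ v
  let β : Sc → Vp → ℝ := fun ξ v => min (c ξ v) 0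
  let y : Sc → Vp → ℝ := fun ξ v => if c ξ v < 0 then (b v : ℝ) else 0
  have hbR : ∀ v, (0:ℝ) ≤ (b v : ℝ) := fun v => by exact_mod_cast hb v
  have hyK : y ∈ Set.Icc (0 : Sc → Vp → ℝ) (fun _ v => (b v : ℝ)) := by
    constructor <;> intro ξ v <;> by_cases hc : c ξ v < 0 <;> simp [y, hc, hbR v]
  have hcy : ∀ ξ v, c ξ v * y ξ v = β ξ v * (b v : ℝ) := by
    intro ξ v
    by_cases hc : c ξ v < 0
    · simp [y, β, hc, min_eq_left hc.le]
    · simp [y, β, hc, min_eq_right (not_lt.1 hc)]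
  have hβA : ∀ ξ v, β ξ v + A ξ v ≤ (p ξ : ℝ) * (w v : ℝ) * μ v := by
    intro ξ v
    have : β ξ v ≤ c ξ v := min_le_left _ _
    simp only [c] at this
    linarith
  have hmult : multA w α β := by
    refine ⟨fun ξ S _ => hl0 _, fun ξ v => min_le_right _ _, fun ξ v hv => ?_⟩
    have := hβA ξ v
    simpa [hv] using this
  have hφ : ∀ v, 0 < w v → phiv p w α β v ≤ μ v := by
    intro v hv
    refine max_le (Finset.sup'_le _ _ fun ξ _ => ?_) (hl0 _)
    have hpw : (0 : ℝ) < (p ξ : ℝ) * (w v : ℝ) := by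
      have := hp ξ
      positivity
    rw [div_le_iff₀ hpw, mul_comm]
    exact hβA ξ v
  have key := hl y hyK
  have hH := H α β hmult
  have hR : ∑ v ∈ univ.filter (fun v => 0 < w v), phiv p w α β v * θ v ≤ ∑ v, μ v * θ v := by
    rw [Finset.sum_filter]
    refine Finset.sum_le_sum fun v _ => ?_
    split_ifs with hv
    · exact mul_le_mul_of_nonneg_right (hφ v hv) (hθ v)
    · exact mul_nonneg (hl0 _) (hθ v)
  have e1 : ∑ i, l i * g y i =
      (∑ ξ, ∑ S ∈ univ.filter (fun S : Finset Vp => S ≠ ∅), α ξ S * inSum x S)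
                  + nu C d b α β - ∑ v, μ v * θ v := by
    rw [Fintype.sum_sum_type, Fintype.sum_prod_type]
    have t1 : ∀ ξ, ∑ S, l (Sum.inl (ξ, S)) * g y (Sum.inl (ξ, S)) =
        (∑ S ∈ univ.filter (fun S : Finset Vp => S ≠ ∅), α ξ S * inSum x S)
        + (∑ S ∈ univ.filter (fun S : Finset Vp => S ≠ ∅),
            α ξ S * ((kxi C (d ξ) S : ℝ) - (S.card : ℝ)))
        - ∑ v, A ξ v * y ξ v := by
      intro ξ
      rw [← swap_aux, ← Finset.sum_add_distrib, ← Finset.sum_sub_distrib, Finset.sum_filter]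
      refine Finset.sum_congr rfl fun S _ => ?_
      by_cases hS : S = ∅
      · simp [g, hS]
      · simp only [g, Sum.elim_inl, hS, if_false, α, ne_eq, not_false_eq_true, if_true]
        ring
    have t2 : ∑ v, l (Sum.inr v) * g y (Sum.inr v) =
        (∑ ξ, ∑ v, (p ξ : ℝ) * (w v : ℝ) * μ v * y ξ v) - ∑ v, μ v * θ v := by
      rw [Finset.sum_comm, ← Finset.sum_sub_distrib]
      refine Finset.sum_congr rfl fun v _ => ?_
      simp only [g, Sum.elim_inr, mul_sub, Finset.mul_sum]
      congr 1
      exact Finset.sum_congr rfl fun ξ _ => by simp only [μ]; ring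
    have t3 : ∑ ξ, ∑ v, β ξ v * (b v : ℝ) =
        (∑ ξ, ∑ v, (p ξ : ℝ) * (w v : ℝ) * μ v * y ξ v) - ∑ ξ, ∑ v, A ξ v * y ξ v := by
      simp only [← hcy, c, sub_mul, Finset.sum_sub_distrib]
    rw [Finset.sum_congr rfl fun ξ _ => t1 ξ, t2, nu, t3]
    simp only [Finset.sum_add_distrib, Finset.sum_sub_distrib]
    ring
  rw [e1] at key
  linarith

/-- Proposition 3 of the paper: the projection of `ŜRI(x̄)` onto the
`θ`-variables is cut out by the projected SRIs over all multipliers `(α,β) ∈ 𝒜`;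
consequently `𝒫` is described by these inequalities. -/
theorem statement_12
    (C : ℚ) (hC : 0 < C) (d : Sc → Vp → ℚ)
    (hd : ∀ ξ v, 0 ≤ d ξ v) (hdC : ∀ ξ v, d ξ v ≤ C)
    (p : Sc → ℚ) (hp : ∀ ξ, 0 < p ξ) (hps : ∑ ξ, p ξ = 1)
    (k : ℕ) (hk : 0 < k)
    (X : Set (Option Vp → Option Vp → ℝ)) (hX : X = Xsub ∨ X = Xcvrp C p d k)
    (w : Vp → ℚ) (hw : ∀ v, 0 ≤ w v) (b : Vp → ℤ) (hb : ∀ v, 0 ≤ b v) :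
    (∀ x ∈ X,
      {θ : Vp → ℝ | ∃ y, (θ, y) ∈ SRIhat C d p w b x}
        = {θ : Vp → ℝ | (∀ v, 0 ≤ θ v) ∧
            ∀ (α : Sc → Finset Vp → ℝ) (β : Sc → Vp → ℝ), multA w α β →
              (∑ ξ, ∑ S ∈ univ.filter (fun S : Finset Vp => S ≠ ∅), α ξ S * inSum x S)
                  + nu C d b α β
                ≤ ∑ v ∈ univ.filter (fun v => 0 < w v), phiv p w α β v * θ v}) ∧
    Pset X C d p w b
      = {xθ : (Option Vp → Option Vp → ℝ) × (Vp → ℝ) |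
          xθ.1 ∈ X ∧ (∀ v, 0 ≤ xθ.2 v) ∧
          ∀ (α : Sc → Finset Vp → ℝ) (β : Sc → Vp → ℝ), multA w α β →
            (∑ ξ, ∑ S ∈ univ.filter (fun S : Finset Vp => S ≠ ∅), α ξ S * inSum xθ.1 S)
                + nu C d b α β
              ≤ ∑ v ∈ univ.filter (fun v => 0 < w v), phiv p w α β v * xθ.2 v} := by
  have main : ∀ x : Option Vp → Option Vp → ℝ, ∀ θ : Vp → ℝ,
      (∃ y, (θ, y) ∈ SRIhat C d p w b x) ↔ ((∀ v, 0 ≤ θ v) ∧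
            ∀ (α : Sc → Finset Vp → ℝ) (β : Sc → Vp → ℝ), multA w α β →
              (∑ ξ, ∑ S ∈ univ.filter (fun S : Finset Vp => S ≠ ∅), α ξ S * inSum x S)
                  + nu C d b α β
                ≤ ∑ v ∈ univ.filter (fun v => 0 < w v), phiv p w α β v * θ v) := by
    intro x θ
    constructor
    · rintro ⟨y, hy⟩
      exact ⟨hy.1, fun α β hA => proj_forward C d p hp w hw b x θ y hy α β hA⟩
    · rintro ⟨hθ, H⟩
      exact proj_backward C d p hp w hw b hb x θ hθ H
  refine ⟨fun x _ => Set.ext fun θ => main x θ, Set.ext fun xθ => ?_⟩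
  exact and_congr_right fun _ => main xθ.1 xθ.2

end VRPSD
end

section
/- Let w ∈ ℚ₊^{V₊}, b ∈ ℤ₊^{V₊}, fix ξ ∈ [N], and let S = {v₁,…,v_ℓ} ⊆ V₊ with w_{v₁} ≤ … ≤ w_{v_ℓ}. Let k' ∈ ℤ_{>0} with k_ξ(S) − k' ≤ b(S), and let j ∈ [ℓ] be the smallest index with k_ξ(S) − k' ≤ Σ_{i∈[j]} b_{v_i}. Define ᾱ^ξ_S := w_{v_j} if k_ξ(S) > k' and ᾱ^ξ_S := 0 otherwise, and β̄^ξ_v := w_v − w_{v_j} if v ∈ {v₁,…,v_{j−1}} and β̄^ξ_v := 0 otherwise. Then (ᾱ^ξ_S, β̄^ξ) is an optimal solution of the dual LP: maximize α(k_ξ(S) − k') + Σ_{v∈V₊} β_v b_v subject to α + β_v ≤ w_v for v ∈ S, β_v ≤ w_v for v ∈ V₊ \ S, α ≥ 0, β ≤ 0; moreover its optimal value equals L*_ξ(S,k') and ᾱ^ξ_S ≤ L*_ξ(S,k'). -/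
set_option autoImplicit false

open Finset

namespace VRPSD

variable {Vp : Type*} [Fintype Vp] [DecidableEq Vp]

/-- The dual multiplier `ᾱ^ξ_S` of Lemma 7 of the paper. -/
noncomputable def alphaBar (C : ℚ) (dxi : Vp → ℚ) (w : Vp → ℚ) {l : ℕ}
    (e : Fin l → Vp) (S : Finset Vp) (k' : ℕ) (j : Fin l) : ℝ :=
  if (k' : ℤ) < kxi C dxi S then (w (e j) : ℝ) else 0

/-- The dual multipliers `β̄^ξ_v` of Lemma 7 of the paper. -/
noncomputable def betaBar (w : Vp → ℚ) {l : ℕ} (e : Fin l → Vp) (j : Fin l) (v : Vp) : ℝ :=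
  if ∃ i : Fin l, i < j ∧ e i = v then (w v : ℝ) - (w (e j) : ℝ) else 0

theorem aux_weak (w : Vp → ℚ) (b : Vp → ℤ) (S : Finset Vp) (K : ℝ)
    (α : ℝ) (β : Vp → ℝ) (hα : 0 ≤ α) (hβ : ∀ v, β v ≤ 0)
    (h1 : ∀ v ∈ S, α + β v ≤ (w v : ℝ)) (h2 : ∀ v ∉ S, β v ≤ (w v : ℝ))
    (y : Vp → ℝ) (hy : ∀ v, 0 ≤ y v ∧ y v ≤ (b v : ℝ)) (hK : K ≤ ∑ v ∈ S, y v) :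
    α * K + ∑ v, β v * (b v : ℝ) ≤ ∑ v, (w v : ℝ) * y v := by
  have e1 : α * K ≤ ∑ v, (if v ∈ S then α * y v else 0) := by
    rw [Finset.sum_ite_mem, Finset.univ_inter, ← Finset.mul_sum]
    exact mul_le_mul_of_nonneg_left hK hα
  have e2 : ∑ v, (if v ∈ S then α * y v else 0) + ∑ v, β v * (b v : ℝ)
      ≤ ∑ v, (w v : ℝ) * y v := by
    rw [← Finset.sum_add_distrib]
    refine Finset.sum_le_sum fun v _ => ?_
    have h3 : β v * (b v : ℝ) ≤ β v * y v := mul_le_mul_of_nonpos_left (hy v).2 (hβ v)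
    split_ifs with hv
    · have := mul_le_mul_of_nonneg_right (h1 v hv) (hy v).1
      linarith
    · have := mul_le_mul_of_nonneg_right (h2 v hv) (hy v).1
      linarith
  linarith

/-- Lemma 7 of the paper: the greedy multipliers `(ᾱ^ξ_S, β̄^ξ)` are an
optimal solution of the dual of the set-cut LP, its value equals `L*_ξ(S,k')`
(the primal optimum), and `ᾱ^ξ_S ≤ L*_ξ(S,k')`. -/
theorem statement_13
    (C : ℚ) (hC : 0 < C) (dxi : Vp → ℚ) (hd : ∀ v, 0 ≤ dxi v)
    (w : Vp → ℚ) (hw : ∀ v, 0 ≤ w v) (b : Vp → ℤ) (hb : ∀ v, 0 ≤ b v)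
    (l : ℕ) (hl : 0 < l) (e : Fin l → Vp) (hinj : Function.Injective e)
    (S : Finset Vp) (hS : S = Finset.image e Finset.univ)
    (hsorted : ∀ i i' : Fin l, i ≤ i' → w (e i) ≤ w (e i'))
    (k' : ℕ) (hk' : 0 < k')
    (hfeas : kxi C dxi S - (k' : ℤ) ≤ ∑ v ∈ S, b v)
    (j : Fin l)
    (hj : kxi C dxi S - (k' : ℤ) ≤ ∑ i ∈ univ.filter (fun i : Fin l => i ≤ j), b (e i))
    (hjmin : ∀ j' : Fin l, j' < j →
      ¬ (kxi C dxi S - (k' : ℤ) ≤ ∑ i ∈ univ.filter (fun i : Fin l => i ≤ j'), b (e i))) :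
    (0 ≤ alphaBar C dxi w e S k' j) ∧
    (∀ v, betaBar w e j v ≤ 0) ∧
    (∀ v ∈ S, alphaBar C dxi w e S k' j + betaBar w e j v ≤ (w v : ℝ)) ∧
    (∀ v ∉ S, betaBar w e j v ≤ (w v : ℝ)) ∧
    IsGreatest
      {r : ℝ | ∃ (α : ℝ) (β : Vp → ℝ), 0 ≤ α ∧ (∀ v, β v ≤ 0) ∧
          (∀ v ∈ S, α + β v ≤ (w v : ℝ)) ∧ (∀ v ∉ S, β v ≤ (w v : ℝ)) ∧
          r = α * ((kxi C dxi S : ℝ) - (k' : ℝ)) + ∑ v, β v * (b v : ℝ)}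
      (alphaBar C dxi w e S k' j * ((kxi C dxi S : ℝ) - (k' : ℝ))
        + ∑ v, betaBar w e j v * (b v : ℝ)) ∧
    IsLeast
      {r : ℝ | ∃ y : Vp → ℝ, (∀ v, 0 ≤ y v ∧ y v ≤ (b v : ℝ)) ∧
          ((kxi C dxi S : ℝ) - (k' : ℝ) ≤ ∑ v ∈ S, y v) ∧ r = ∑ v, (w v : ℝ) * y v}
      (alphaBar C dxi w e S k' j * ((kxi C dxi S : ℝ) - (k' : ℝ))
        + ∑ v, betaBar w e j v * (b v : ℝ)) ∧
    alphaBar C dxi w e S k' j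
      ≤ alphaBar C dxi w e S k' j * ((kxi C dxi S : ℝ) - (k' : ℝ))
        + ∑ v, betaBar w e j v * (b v : ℝ) := by
  classical
  set P : Finset Vp := Finset.image e (univ.filter (fun i : Fin l => i < j)) with hP
  set K : ℤ := kxi C dxi S - (k' : ℤ) with hKdef
  have hKr : ((kxi C dxi S : ℝ) - (k' : ℝ)) = (K : ℝ) := by rw [hKdef]; push_cast; ring
  have hmemP : ∀ v, v ∈ P ↔ ∃ i : Fin l, i < j ∧ e i = v := by
    intro v; simp [hP]
  have hbeta : ∀ v, betaBar w e j v = if v ∈ P then (w v : ℝ) - (w (e j) : ℝ) else 0 := by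
    intro v; unfold betaBar; simp only [hmemP]
  have halpha : alphaBar C dxi w e S k' j = if 0 < K then (w (e j) : ℝ) else 0 := by
    unfold alphaBar
    have : ((k' : ℤ) < kxi C dxi S) ↔ 0 < K := by rw [hKdef]; omega
    simp only [this]
  have hsumP : ∑ v ∈ P, b v = ∑ i ∈ univ.filter (fun i : Fin l => i < j), b (e i) := by
    rw [hP, Finset.sum_image (fun x _ y _ h => hinj h)]
  have hjP : e j ∉ P := by
    rw [hmemP]; rintro ⟨i, hi, h⟩; exact absurd (hinj h) (ne_of_lt hi)
  have hPS : P ⊆ S := by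
    rw [hS, hP]; exact Finset.image_subset_image (Finset.filter_subset _ _)
  have hjS : e j ∈ S := by rw [hS]; simp
  have hup : K ≤ ∑ v ∈ P, b v + b (e j) := by
    have : univ.filter (fun i : Fin l => i ≤ j) = insert j (univ.filter (fun i : Fin l => i < j)) := by
      ext i; simp [le_iff_eq_or_lt]
    rw [this, Finset.sum_insert (by simp), ← hsumP] at hj
    linarith
  have hPpos : P.Nonempty → ∑ v ∈ P, b v < K := by
    rintro ⟨v, hv⟩
    obtain ⟨i, hi, -⟩ := (hmemP v).1 hv
    have hjv : 0 < j.val := lt_of_le_of_lt (Nat.zero_le _) (Fin.lt_def.1 hi)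
    have h := hjmin ⟨j.val - 1, by omega⟩ (by rw [Fin.lt_def]; simp; omega)
    have h2 : univ.filter (fun i : Fin l => i ≤ (⟨j.val - 1, by omega⟩ : Fin l))
        = univ.filter (fun i : Fin l => i < j) := by
      ext i; simp only [mem_filter, mem_univ, true_and, Fin.le_def, Fin.lt_def]; omega
    rw [h2, ← hsumP] at h
    exact not_le.1 h
  have hBnn : 0 ≤ ∑ v ∈ P, b v := Finset.sum_nonneg fun v _ => hb v
  have hK0 : 0 < K → ∑ v ∈ P, b v + 1 ≤ K := by
    intro h
    rcases P.eq_empty_or_nonempty with h0 | h0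
    · rw [h0]; simp; omega
    · exact hPpos h0
  have hPe : ¬ 0 < K → P = ∅ := by
    intro h
    rcases P.eq_empty_or_nonempty with h0 | h0
    · exact h0
    · exact absurd (lt_of_le_of_lt hBnn (hPpos h0)) h
  have hwr : ∀ v, (0 : ℝ) ≤ (w v : ℝ) := fun v => by exact_mod_cast hw v
  have hbr : ∀ v, (0 : ℝ) ≤ (b v : ℝ) := fun v => by exact_mod_cast hb v
  have hwP : ∀ v ∈ P, (w v : ℝ) ≤ (w (e j) : ℝ) := by
    intro v hv
    obtain ⟨i, hi, rfl⟩ := (hmemP v).1 hv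
    exact_mod_cast hsorted i j hi.le
  have A1 : 0 ≤ alphaBar C dxi w e S k' j := by
    rw [halpha]; split_ifs
    · exact hwr _
    · exact le_rfl
  have A2 : ∀ v, betaBar w e j v ≤ 0 := by
    intro v; rw [hbeta]; split_ifs with h
    · linarith [hwP v h]
    · exact le_rfl
  have A3 : ∀ v ∈ S, alphaBar C dxi w e S k' j + betaBar w e j v ≤ (w v : ℝ) := by
    intro v hv
    by_cases hK : 0 < K
    · rw [halpha, if_pos hK, hbeta]; split_ifs with h
      · linarith
      · rw [hS] at hv
        obtain ⟨i, -, rfl⟩ := Finset.mem_image.1 hv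
        have hji : j ≤ i := by
          by_contra hc
          exact h ((hmemP _).2 ⟨i, not_le.1 hc, rfl⟩)
        have : (w (e j) : ℝ) ≤ w (e i) := by exact_mod_cast hsorted j i hji
        linarith
    · rw [halpha, if_neg hK]; linarith [A2 v, hwr v]
  have A4 : ∀ v ∉ S, betaBar w e j v ≤ (w v : ℝ) := fun v _ => (A2 v).trans (hwr v)
  have hBcast : ((∑ v ∈ P, b v : ℤ) : ℝ) = ∑ v ∈ P, (b v : ℝ) := by push_cast; rfl
  have hbsum : ∑ v, betaBar w e j v * (b v : ℝ)
      = ∑ v ∈ P, (w v : ℝ) * b v - (w (e j) : ℝ) * ∑ v ∈ P, (b v : ℝ) := by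
    simp only [hbeta, ite_mul, zero_mul]
    rw [Finset.sum_ite_mem, Finset.univ_inter, Finset.mul_sum, ← Finset.sum_sub_distrib]
    exact Finset.sum_congr rfl fun v _ => by ring
  rw [hKr]
  -- optimal primal solution
  have hprimal : ∃ y : Vp → ℝ, (∀ v, 0 ≤ y v ∧ y v ≤ (b v : ℝ)) ∧
      ((K : ℝ) ≤ ∑ v ∈ S, y v) ∧
      alphaBar C dxi w e S k' j * (K : ℝ) + ∑ v, betaBar w e j v * (b v : ℝ)
        = ∑ v, (w v : ℝ) * y v := by
    by_cases hK : 0 < K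
    · have hup' : (K : ℝ) ≤ ∑ v ∈ P, (b v : ℝ) + b (e j) := by
        rw [← hBcast]; exact_mod_cast hup
      have hlo' : ∑ v ∈ P, (b v : ℝ) + 1 ≤ (K : ℝ) := by
        rw [← hBcast]; exact_mod_cast hK0 hK
      set y : Vp → ℝ := fun v => (if v ∈ P then (b v : ℝ) else 0)
        + (if v = e j then (K : ℝ) - ∑ v ∈ P, (b v : ℝ) else 0) with hy
      refine ⟨y, ?_, ?_, ?_⟩
      · intro v
        simp only [hy]
        by_cases hv : v = e j
        · subst hv
          rw [if_neg hjP, if_pos rfl]; constructor <;> linarith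
        · rw [if_neg hv]; split_ifs
          · simp [hbr v]
          · simp [hbr v]
      · simp only [hy]
        rw [Finset.sum_add_distrib, Finset.sum_ite_mem, Finset.inter_eq_right.2 hPS,
          Finset.sum_ite_eq', if_pos hjS]
        linarith
      · rw [hbsum, halpha, if_pos hK]
        simp only [hy, mul_add, mul_ite, mul_zero]
        rw [Finset.sum_add_distrib, Finset.sum_ite_mem, Finset.univ_inter,
          Finset.sum_ite_eq', if_pos (Finset.mem_univ _)]
        ring
    · refine ⟨fun _ => 0, fun v => ⟨le_rfl, hbr v⟩, ?_, ?_⟩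
      · simp only [Finset.sum_const_zero]; exact_mod_cast not_lt.1 hK
      · rw [hbsum, halpha, if_neg hK, hPe hK]; simp
  obtain ⟨y, hy1, hy2, hy3⟩ := hprimal
  refine ⟨A1, A2, A3, A4, ⟨⟨_, _, A1, A2, A3, A4, rfl⟩, ?_⟩, ⟨⟨y, hy1, hy2, hy3⟩, ?_⟩, ?_⟩
  · rintro r ⟨α, β, h1, h2, h3, h4, rfl⟩
    rw [hy3]
    exact aux_weak w b S K α β h1 h2 h3 h4 y hy1 hy2
  · rintro r ⟨z, hz1, hz2, rfl⟩
    exact aux_weak w b S K _ _ A1 A2 A3 A4 z hz1 hz2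
  · rw [hbsum, halpha]
    by_cases hK : 0 < K
    · rw [if_pos hK]
      have hlo' : ∑ v ∈ P, (b v : ℝ) + 1 ≤ (K : ℝ) := by
        rw [← hBcast]; exact_mod_cast hK0 hK
      have h5 : 0 ≤ ∑ v ∈ P, (w v : ℝ) * b v :=
        Finset.sum_nonneg fun v _ => mul_nonneg (hwr v) (hbr v)
      have := mul_le_mul_of_nonneg_left hlo' (hwr (e j))
      linarith
    · rw [if_neg hK, hPe hK]; simp

end VRPSD
end

section
/- Let w ∈ ℚ₊^{V₊}, b ∈ ℤ₊^{V₊}, ∅ ⊊ S ⊆ V₊, and k' ∈ ℤ_{>0} with k_ξ(S) − k' ≤ b(S) for every scenario ξ ∈ [N]. For each ξ let (ᾱ^ξ_S, β̄^ξ) be the optimal dual solution of the preceding lemma, and define multipliers α̂^ξ_{S'} := p_ξ ᾱ^ξ_S if S' = S and 0 otherwise, and β̂^ξ_v := p_ξ β̄^ξ_v. Then (α̂, β̂) ∈ 𝒜, and for every x̄ ∈ 𝒳 with x̄(E(S)) ≤ |S| − k', every θ ∈ proj_θ(Γ(x̄, α̂, β̂)) satisfies the set cut θ(S) ≥ L*(S,k')·(1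 + x̄(E(S)) − |S| + k'), where L*(S,k') := Σ_ξ p_ξ L*_ξ(S,k') and θ(S) := Σ_{v∈S} θ_v. In particular, if the inequality x(E(S)) ≤ |S| − k' is valid for 𝒫, then the set cut θ(S) ≥ L*(S,k')·(1 + x(E(S)) − |S| + k') is valid for 𝒫. -/
set_option autoImplicit false

open Finset

namespace VRPSD

variable {Vp : Type*} [Fintype Vp] [DecidableEq Vp]
variable {Sc : Type*} [Fintype Sc] [Nonempty Sc]

/-- `L*_ξ(S,k')`: the optimal value of the set-cut LP for scenario `ξ`. -/
noncomputable def LstarSet (C : ℚ) (dxi : Vp → ℚ) (w : Vp → ℚ) (b : Vp → ℤ)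
    (S : Finset Vp) (k' : ℕ) : ℝ :=
  sInf {r : ℝ | ∃ y : Vp → ℝ, (∀ v, 0 ≤ y v ∧ y v ≤ (b v : ℝ)) ∧
      ((kxi C dxi S : ℝ) - (k' : ℝ) ≤ ∑ v ∈ S, y v) ∧ r = ∑ v, (w v : ℝ) * y v}

/-- Abstract scenario lemma. -/
lemma key_abs (w : Vp → ℚ) (hw : ∀ v, 0 ≤ w v) (b : Vp → ℤ) (hb : ∀ v, 0 ≤ b v)
    (S T : Finset Vp) (v0 : Vp) (hTS : T ⊆ S) (hv0 : v0 ∈ S) (hv0T : v0 ∉ T)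
    (h1 : ∀ v ∈ T, w v ≤ w v0) (h2 : ∀ v ∈ S, v ∉ T → w v0 ≤ w v) (K : ℤ)
    (hK : (K ≤ 0 ∧ T = ∅) ∨ (0 < K ∧ ∑ v ∈ T, b v + 1 ≤ K ∧ K ≤ ∑ v ∈ T, b v + b v0))
    (a : ℝ) (ha : a = if 0 < K then (w v0 : ℝ) else 0)
    (β : Vp → ℝ) (hβ : ∀ v, β v = if v ∈ T then (w v : ℝ) - (w v0 : ℝ) else 0) :
    0 ≤ a ∧ (∀ v, β v ≤ 0) ∧
    (∀ v, β v + (if v ∈ S then a else 0) ≤ if v ∈ S then (w v : ℝ) else 0) ∧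
    a ≤ a * K + ∑ v, β v * (b v : ℝ) ∧
    sInf {r : ℝ | ∃ y : Vp → ℝ, (∀ v, 0 ≤ y v ∧ y v ≤ (b v : ℝ)) ∧
      ((K : ℝ) ≤ ∑ v ∈ S, y v) ∧ r = ∑ v, (w v : ℝ) * y v} = a * K + ∑ v, β v * (b v : ℝ) := by
  have hwr : ∀ v, (0 : ℝ) ≤ w v := fun v => by exact_mod_cast hw v
  have hbr : ∀ v, (0 : ℝ) ≤ b v := fun v => by exact_mod_cast hb v
  have h1r : ∀ v ∈ T, (w v : ℝ) ≤ w v0 := fun v hv => by exact_mod_cast h1 v hv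
  have h2r : ∀ v ∈ S, v ∉ T → (w v0 : ℝ) ≤ w v := fun v hv hv' => by exact_mod_cast h2 v hv hv'
  have c1 : 0 ≤ a := by rw [ha]; split_ifs <;> simp [hwr]
  have c2 : ∀ v, β v ≤ 0 := by
    intro v; rw [hβ]; split_ifs with h
    · linarith [h1r v h]
    · exact le_rfl
  have ha' : a ≤ w v0 := by rw [ha]; split_ifs <;> simp [hwr]
  have c3 : ∀ v, β v + (if v ∈ S then a else 0) ≤ if v ∈ S then (w v : ℝ) else 0 := by
    intro v
    rw [hβ]
    by_cases hS : v ∈ S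
    · by_cases hT : v ∈ T
      · simp only [hS, hT, if_true]; linarith
      · simp only [hS, hT, if_true, if_false]; linarith [h2r v hS hT]
    · have hT : v ∉ T := fun h => hS (hTS h)
      simp [hS, hT]
  have hsum : ∑ v, β v * (b v : ℝ) = ∑ v ∈ T, (w v : ℝ) * b v - w v0 * ∑ v ∈ T, (b v : ℝ) := by
    simp only [hβ, ite_mul, zero_mul]
    rw [Finset.sum_ite_mem, Finset.univ_inter, Finset.mul_sum, ← Finset.sum_sub_distrib]
    exact Finset.sum_congr rfl fun v _ => by ring
  have hTn : 0 ≤ ∑ v ∈ T, (w v : ℝ) * b v :=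
    Finset.sum_nonneg fun v _ => mul_nonneg (hwr v) (hbr v)
  have c4 : a ≤ a * K + ∑ v, β v * (b v : ℝ) := by
    rw [hsum]
    rcases hK with ⟨h, rfl⟩ | ⟨h, h3, h4⟩
    · have : a = 0 := by rw [ha, if_neg (not_lt.2 h)]
      simp [this]
    · have : a = w v0 := by rw [ha, if_pos h]
      rw [this]
      have h3r : ∑ v ∈ T, (b v : ℝ) + 1 ≤ K := by exact_mod_cast h3
      nlinarith [hwr v0]
  refine ⟨c1, c2, c3, c4, ?_⟩
  apply IsLeast.csInf_eq
  constructor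
  · rw [hsum]
    rcases hK with ⟨h, rfl⟩ | ⟨h, h3, h4⟩
    · have : a = 0 := by rw [ha, if_neg (not_lt.2 h)]
      refine ⟨fun _ => 0, fun v => ⟨le_rfl, hbr v⟩, ?_, ?_⟩
      · simpa using h
      · simp [this]
    · have : a = w v0 := by rw [ha, if_pos h]
      rw [this]
      have h3r : ∑ v ∈ T, (b v : ℝ) + 1 ≤ K := by exact_mod_cast h3
      have h4r : (K : ℝ) ≤ ∑ v ∈ T, (b v : ℝ) + b v0 := by exact_mod_cast h4
      have hsplit : ∀ (f : Vp → ℝ) (U : Finset Vp), T ⊆ U → v0 ∈ U →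
          ∑ v ∈ U, f v * ((if v ∈ T then (b v : ℝ) else 0) +
            if v = v0 then (K : ℝ) - ∑ v ∈ T, (b v : ℝ) else 0) =
          ∑ v ∈ T, f v * b v + f v0 * (K - ∑ v ∈ T, (b v : ℝ)) := by
        intro f U hU hU0
        simp only [mul_add, mul_ite, mul_zero, Finset.sum_add_distrib]
        rw [Finset.sum_ite_mem, Finset.inter_eq_right.2 hU, Finset.sum_ite_eq', if_pos hU0]
      refine ⟨fun v => (if v ∈ T then (b v : ℝ) else 0) +
            if v = v0 then (K : ℝ) - ∑ v ∈ T, (b v : ℝ) else 0, fun v => ?_, ?_, ?_⟩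
      · by_cases hv : v = v0
        · subst hv
          simp only [hv0T, if_true, if_false]
          constructor <;> linarith
        · by_cases hT : v ∈ T <;> simp [hv, hT, hbr]
      · have := hsplit (fun _ => 1) S hTS hv0
        simp only [one_mul] at this
        rw [this]; linarith
      · rw [hsplit _ univ (Finset.subset_univ _) (Finset.mem_univ _)]
        ring
  · rintro r ⟨y, hy, hyS, rfl⟩
    have e1 : ∑ v, (β v + if v ∈ S then a else 0) * y v ≤ ∑ v, (w v : ℝ) * y v := by
      refine Finset.sum_le_sum fun v _ => mul_le_mul_of_nonneg_right ((c3 v).trans ?_) (hy v).1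
      split_ifs
      · exact le_rfl
      · exact hwr v
    have e2 : ∑ v, (β v + if v ∈ S then a else 0) * y v
        = ∑ v, β v * y v + a * ∑ v ∈ S, y v := by
      simp only [add_mul, Finset.sum_add_distrib, ite_mul, zero_mul]
      rw [Finset.sum_ite_mem, Finset.univ_inter, Finset.mul_sum]
    have e3 : ∑ v, β v * (b v : ℝ) ≤ ∑ v, β v * y v :=
      Finset.sum_le_sum fun v _ => mul_le_mul_of_nonpos_left (hy v).2 (c2 v)
    have e4 := mul_le_mul_of_nonneg_left hyS c1
    linarith

/-- Concrete scenario lemma. -/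
lemma key_sc (C : ℚ) (dxi : Vp → ℚ) (w : Vp → ℚ) (hw : ∀ v, 0 ≤ w v)
    (b : Vp → ℤ) (hb : ∀ v, 0 ≤ b v)
    (l : ℕ) (e : Fin l → Vp) (hinj : Function.Injective e)
    (S : Finset Vp) (hS : S = Finset.image e Finset.univ)
    (hsorted : ∀ i i' : Fin l, i ≤ i' → w (e i) ≤ w (e i'))
    (k' : ℕ) (j : Fin l)
    (hj : kxi C dxi S - (k' : ℤ) ≤ ∑ i ∈ univ.filter (fun i : Fin l => i ≤ j), b (e i))
    (hjmin : ∀ j' : Fin l, j' < j →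
      ¬ (kxi C dxi S - (k' : ℤ) ≤ ∑ i ∈ univ.filter (fun i : Fin l => i ≤ j'), b (e i))) :
    0 ≤ alphaBar C dxi w e S k' j ∧ (∀ v, betaBar w e j v ≤ 0) ∧
    (∀ v, betaBar w e j v + (if v ∈ S then alphaBar C dxi w e S k' j else 0)
      ≤ if v ∈ S then (w v : ℝ) else 0) ∧
    alphaBar C dxi w e S k' j ≤ alphaBar C dxi w e S k' j * ((kxi C dxi S : ℝ) - k')
      + ∑ v, betaBar w e j v * (b v : ℝ) ∧
    LstarSet C dxi w b S k' = alphaBar C dxi w e S k' j * ((kxi C dxi S : ℝ) - k')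
      + ∑ v, betaBar w e j v * (b v : ℝ) := by
  have hTsum : ∑ v ∈ (univ.filter (fun i : Fin l => i < j)).image e, b v
      = ∑ i ∈ univ.filter (fun i : Fin l => i < j), b (e i) :=
    Finset.sum_image fun x _ y _ h => hinj h
  have hle : ∑ i ∈ univ.filter (fun i : Fin l => i ≤ j), b (e i)
      = ∑ i ∈ univ.filter (fun i : Fin l => i < j), b (e i) + b (e j) := by
    have : univ.filter (fun i : Fin l => i ≤ j)
        = insert j (univ.filter (fun i : Fin l => i < j)) := by
      ext i; simp [le_iff_eq_or_lt]
    rw [this, Finset.sum_insert (by simp)]; ring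
  have := key_abs w hw b hb S ((univ.filter (fun i : Fin l => i < j)).image e) (e j)
    (by rw [hS]; exact Finset.image_subset_image (Finset.subset_univ _))
    (by rw [hS]; simp)
    (by
      intro h
      obtain ⟨i, hi, hij⟩ := Finset.mem_image.1 h
      rw [hinj hij] at hi
      simp at hi)
    (by
      intro v hv
      obtain ⟨i, hi, rfl⟩ := Finset.mem_image.1 hv
      exact hsorted _ _ (le_of_lt (by simpa using hi)))
    (by
      intro v hv hv'
      rw [hS] at hv
      obtain ⟨i, _, rfl⟩ := Finset.mem_image.1 hv
      refine hsorted _ _ (not_lt.1 fun h => hv' (Finset.mem_image.2 ⟨i, by simpa using h, rfl⟩)))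
    (kxi C dxi S - k')
    (by
      by_cases hK : kxi C dxi S - (k' : ℤ) ≤ 0
      · left
        refine ⟨hK, ?_⟩
        rw [Finset.image_eq_empty, Finset.filter_eq_empty_iff]
        intro i _ hi
        exact hjmin i hi (hK.trans (Finset.sum_nonneg fun v _ => hb _))
      · right
        rw [hTsum, ← hle]
        refine ⟨not_le.1 hK, ?_, hj⟩
        by_cases hj0 : j.val = 0
        · have : univ.filter (fun i : Fin l => i < j) = ∅ := by
            rw [Finset.filter_eq_empty_iff]
            intro i _ hi
            have : i.val < j.val := hi
            omega
          rw [this, Finset.sum_empty]; omega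
        · have h := hjmin ⟨j.val - 1, by omega⟩ (by rw [Fin.lt_def]; simp only; omega)
          have h' : univ.filter (fun i : Fin l => i ≤ ⟨j.val - 1, by omega⟩)
              = univ.filter (fun i : Fin l => i < j) := by
            ext i
            simp only [Finset.mem_filter, Finset.mem_univ, true_and, Fin.le_def, Fin.lt_def]
            omega
          rw [h'] at h
          omega)
    (alphaBar C dxi w e S k' j) (by simp [alphaBar, sub_pos])
    (betaBar w e j) (by
      intro v
      simp [betaBar])
  push_cast at this
  exact this

/-- `SRIhat` points lie in `Γ`-type aggregated inequalities; the final arithmetic. -/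
lemma final_arith (p : Sc → ℚ) (hp : ∀ ξ, 0 < p ξ) (w : Vp → ℚ) (b : Vp → ℤ) (S : Finset Vp)
    (a : Sc → ℝ) (β : Sc → Vp → ℝ) (L κ : Sc → ℝ) (k' t : ℝ) (ht : t ≤ S.card - k')
    (h3 : ∀ ξ v, β ξ v + (if v ∈ S then a ξ else 0) ≤ if v ∈ S then (w v : ℝ) else 0)
    (h4 : ∀ ξ, a ξ ≤ a ξ * (κ ξ - k') + ∑ v, β ξ v * (b v : ℝ))
    (h5 : ∀ ξ, L ξ = a ξ * (κ ξ - k') + ∑ v, β ξ v * (b v : ℝ))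
    (θ : Vp → ℝ) (y : Sc → Vp → ℝ) (hy : y ∈ Box b)
    (hθ : ∀ v, (∑ ξ, (p ξ : ℝ) * (w v : ℝ) * y ξ v) ≤ θ v)
    (hG : ∑ ξ, (p ξ : ℝ) * (a ξ * (t + κ ξ - S.card) + ∑ v, β ξ v * (b v : ℝ))
      ≤ ∑ ξ, (p ξ : ℝ) * ∑ v, (β ξ v + if v ∈ S then a ξ else 0) * y ξ v) :
    (∑ ξ, (p ξ : ℝ) * L ξ) * (1 + t - (S.card : ℝ) + k') ≤ ∑ v ∈ S, θ v := by
  have hpr : ∀ ξ, (0 : ℝ) < p ξ := fun ξ => by exact_mod_cast hp ξ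
  calc _ = ∑ ξ, (p ξ : ℝ) * (L ξ * (1 + t - (S.card : ℝ) + k')) := by
        rw [Finset.sum_mul]; exact Finset.sum_congr rfl fun _ _ => by ring
    _ ≤ ∑ ξ, (p ξ : ℝ) * (a ξ * (t + κ ξ - S.card) + ∑ v, β ξ v * (b v : ℝ)) := by
        refine Finset.sum_le_sum fun ξ _ => mul_le_mul_of_nonneg_left ?_ (hpr ξ).le
        have e1 := h4 ξ
        rw [← h5 ξ] at e1
        have e2 : 0 ≤ (L ξ - a ξ) * (S.card - k' - t) :=
          mul_nonneg (by linarith) (by linarith)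
        have e3 := h5 ξ
        linarith
    _ ≤ _ := hG
    _ ≤ ∑ ξ, (p ξ : ℝ) * ∑ v, (if v ∈ S then (w v : ℝ) else 0) * y ξ v :=
        Finset.sum_le_sum fun ξ _ => mul_le_mul_of_nonneg_left
          (Finset.sum_le_sum fun v _ => mul_le_mul_of_nonneg_right (h3 ξ v) (hy ξ v).1) (hpr ξ).le
    _ = ∑ v ∈ S, ∑ ξ, (p ξ : ℝ) * (w v : ℝ) * y ξ v := by
        rw [Finset.sum_comm]
        refine Finset.sum_congr rfl fun ξ _ => ?_
        simp only [ite_mul, zero_mul]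
        rw [Finset.sum_ite_mem, Finset.univ_inter, Finset.mul_sum]
        exact Finset.sum_congr rfl fun v _ => by ring
    _ ≤ _ := Finset.sum_le_sum fun v _ => hθ v

/-- Theorem 3 of the paper: the multipliers built from the optimal duals of
Lemma 7 belong to `𝒜`, and the corresponding projected SRI dominates the set cut
`θ(S) ≥ L*(S,k')·(1 + x(E(S)) − |S| + k')`; in particular, if `x(E(S)) ≤ |S| − k'` is
valid for `𝒫`, then the set cut is valid for `𝒫`. -/
theorem statement_14
    (C : ℚ) (hC : 0 < C) (d : Sc → Vp → ℚ)
    (hd : ∀ ξ v, 0 ≤ d ξ v) (hdC : ∀ ξ v, d ξ v ≤ C)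
    (p : Sc → ℚ) (hp : ∀ ξ, 0 < p ξ) (hps : ∑ ξ, p ξ = 1)
    (k : ℕ) (hk : 0 < k)
    (X : Set (Option Vp → Option Vp → ℝ)) (hX : X = Xsub ∨ X = Xcvrp C p d k)
    (w : Vp → ℚ) (hw : ∀ v, 0 ≤ w v) (b : Vp → ℤ) (hb : ∀ v, 0 ≤ b v)
    (l : ℕ) (hl : 0 < l) (e : Fin l → Vp) (hinj : Function.Injective e)
    (S : Finset Vp) (hSne : S.Nonempty) (hS : S = Finset.image e Finset.univ)
    (hsorted : ∀ i i' : Fin l, i ≤ i' → w (e i) ≤ w (e i'))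
    (k' : ℕ) (hk' : 0 < k')
    (hfeas : ∀ ξ, kxi C (d ξ) S - (k' : ℤ) ≤ ∑ v ∈ S, b v)
    (jf : Sc → Fin l)
    (hj : ∀ ξ, kxi C (d ξ) S - (k' : ℤ)
        ≤ ∑ i ∈ univ.filter (fun i : Fin l => i ≤ jf ξ), b (e i))
    (hjmin : ∀ ξ, ∀ j' : Fin l, j' < jf ξ →
      ¬ (kxi C (d ξ) S - (k' : ℤ)
          ≤ ∑ i ∈ univ.filter (fun i : Fin l => i ≤ j'), b (e i))) :
    multA w
      (fun ξ S' => if S' = S then (p ξ : ℝ) * alphaBar C (d ξ) w e S k' (jf ξ) else 0)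
      (fun ξ v => (p ξ : ℝ) * betaBar w e (jf ξ) v) ∧
    (∀ x ∈ X, inSum x S ≤ (S.card : ℝ) - (k' : ℝ) →
      ∀ θ : Vp → ℝ,
        (∃ y, (θ, y) ∈ GammaSet C d p w b x
          (fun ξ S' => if S' = S then (p ξ : ℝ) * alphaBar C (d ξ) w e S k' (jf ξ) else 0)
          (fun ξ v => (p ξ : ℝ) * betaBar w e (jf ξ) v)) →
        (∑ ξ, (p ξ : ℝ) * LstarSet C (d ξ) w b S k')
            * (1 + inSum x S - (S.card : ℝ) + (k' : ℝ))
          ≤ ∑ v ∈ S, θ v) ∧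
    ((∀ xθ ∈ Pset X C d p w b, inSum xθ.1 S ≤ (S.card : ℝ) - (k' : ℝ)) →
      ∀ xθ ∈ Pset X C d p w b,
        (∑ ξ, (p ξ : ℝ) * LstarSet C (d ξ) w b S k')
            * (1 + inSum xθ.1 S - (S.card : ℝ) + (k' : ℝ))
          ≤ ∑ v ∈ S, xθ.2 v) := by
  have H := fun ξ => key_sc C (d ξ) w hw b hb l e hinj S hS hsorted k' (jf ξ) (hj ξ) (hjmin ξ)
  have hpr : ∀ ξ, (0 : ℝ) < p ξ := fun ξ => by exact_mod_cast hp ξ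
  have hα : ∀ ξ v, ∑ S' ∈ univ.filter (fun S' : Finset Vp => v ∈ S'),
      (if S' = S then (p ξ : ℝ) * alphaBar C (d ξ) w e S k' (jf ξ) else 0)
      = (p ξ : ℝ) * (if v ∈ S then alphaBar C (d ξ) w e S k' (jf ξ) else 0) := by
    intro ξ v
    rw [Finset.sum_ite_eq']
    simp
  refine ⟨⟨?_, ?_, ?_⟩, ?_, ?_⟩
  · intro ξ S' _
    dsimp only
    split_ifs
    · exact mul_nonneg (hpr ξ).le (H ξ).1
    · exact le_rfl
  · intro ξ v
    exact mul_nonpos_of_nonneg_of_nonpos (hpr ξ).le ((H ξ).2.1 v)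
  · intro ξ v hv
    rw [hα, ← mul_add]
    refine mul_nonpos_of_nonneg_of_nonpos (hpr ξ).le (((H ξ).2.2.1 v).trans ?_)
    simp [hv]
  · rintro x - hx θ ⟨y, -, hy, hG, hθ⟩
    refine final_arith p hp w b S (fun ξ => alphaBar C (d ξ) w e S k' (jf ξ))
      (fun ξ => betaBar w e (jf ξ)) _ (fun ξ => (kxi C (d ξ) S : ℝ)) k' _ hx
      (fun ξ => (H ξ).2.2.1) (fun ξ => (H ξ).2.2.2.1) (fun ξ => (H ξ).2.2.2.2) θ y hy hθ ?_
    simp only [hα, nu, ite_mul, zero_mul] at hG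
    simp only [Finset.sum_ite_eq', Finset.mem_filter, Finset.mem_univ, true_and,
      if_pos (show S ≠ ∅ from hSne.ne_empty)] at hG
    refine (le_of_eq ?_).trans (hG.trans (le_of_eq ?_))
    · rw [← Finset.sum_add_distrib, ← Finset.sum_add_distrib]
      refine Finset.sum_congr rfl fun ξ _ => ?_
      simp only [mul_assoc]
      rw [← Finset.mul_sum]
      ring
    · refine Finset.sum_congr rfl fun ξ _ => ?_
      rw [Finset.mul_sum]
      exact Finset.sum_congr rfl fun v _ => by ring
  · rintro hval ⟨x, θ⟩ hxθ
    have hx := hval _ hxθ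
    obtain ⟨-, y, -, hy, hS', hθ⟩ := hxθ
    refine final_arith p hp w b S (fun ξ => alphaBar C (d ξ) w e S k' (jf ξ))
      (fun ξ => betaBar w e (jf ξ)) _ (fun ξ => (kxi C (d ξ) S : ℝ)) k' _ hx
      (fun ξ => (H ξ).2.2.1) (fun ξ => (H ξ).2.2.2.1) (fun ξ => (H ξ).2.2.2.2) θ y hy hθ ?_
    refine Finset.sum_le_sum fun ξ _ => mul_le_mul_of_nonneg_left ?_ (hpr ξ).le
    have e2 : ∑ v, (betaBar w e (jf ξ) v
          + if v ∈ S then alphaBar C (d ξ) w e S k' (jf ξ) else 0) * y ξ v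
        = ∑ v, betaBar w e (jf ξ) v * y ξ v
          + alphaBar C (d ξ) w e S k' (jf ξ) * ∑ v ∈ S, y ξ v := by
      simp only [add_mul, Finset.sum_add_distrib, ite_mul, zero_mul]
      rw [Finset.sum_ite_mem, Finset.univ_inter, Finset.mul_sum]
    have e3 : ∑ v, betaBar w e (jf ξ) v * (b v : ℝ) ≤ ∑ v, betaBar w e (jf ξ) v * y ξ v :=
      Finset.sum_le_sum fun v _ => mul_le_mul_of_nonpos_left (hy ξ v).2 ((H ξ).2.1 v)
    have e4 := mul_le_mul_of_nonneg_left (hS' S hSne ξ) (H ξ).1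
    dsimp only at e4 ⊢
    rw [e2]
    linarith

end VRPSD
end

section
/- Let H = (S₁,…,S_ℓ) be a partial route. For every contiguous sub-tuple H' = (S_i,…,S_j) of H and every x̄ ∈ 𝒳, x̄(H') − |V₊(H')| + 1 ≥ W_OF(x̄; H) − 1. -/
set_option autoImplicit false

open Finset

namespace VRPSD

variable {Vp : Type*} [Fintype Vp] [DecidableEq Vp]
variable {Sc : Type*} [Fintype Sc] [Nonempty Sc]

lemma inSum_eq (x : Option Vp → Option Vp → ℝ) (h0 : ∀ u, x u u = 0) (S : Finset Vp) :
    inSum x S = (1/2) * ∑ u ∈ S, ∑ v ∈ S, x (some u) (some v) := by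
  unfold inSum
  congr 1
  refine Finset.sum_congr rfl fun u _ => ?_
  refine Finset.sum_subset (Finset.filter_subset _ _) fun v hv hv' => ?_
  have : v = u := by
    by_contra h
    exact hv' (Finset.mem_filter.2 ⟨hv, h⟩)
  rw [this, h0]

lemma crossSum_symm (x : Option Vp → Option Vp → ℝ) (hs : ∀ u v, x u v = x v u)
    (S T : Finset Vp) : crossSum x S T = crossSum x T S := by
  unfold crossSum
  rw [Finset.sum_comm]
  exact Finset.sum_congr rfl fun u _ => Finset.sum_congr rfl fun v _ => hs _ _

lemma inSum_union (x : Option Vp → Option Vp → ℝ) (hs : ∀ u v, x u v = x v u)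
    (h0 : ∀ u, x u u = 0) (S T : Finset Vp) (h : Disjoint S T) :
    inSum x (S ∪ T) = inSum x S + inSum x T + crossSum x S T := by
  have h1 := crossSum_symm x hs S T
  rw [inSum_eq x h0, inSum_eq x h0, inSum_eq x h0, Finset.sum_union h]
  simp only [Finset.sum_union h, Finset.sum_add_distrib]
  unfold crossSum at *
  linarith

/-- slack -/
noncomputable def qq (x : Option Vp → Option Vp → ℝ) (S : Finset Vp) : ℝ :=
  inSum x S - (S.card : ℝ) + 1

/-- cross slack -/
noncomputable def cc (x : Option Vp → Option Vp → ℝ) (S T : Finset Vp) : ℝ :=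
  crossSum x S T - 1

/-- recursive form -/
noncomputable def FF (x : Option Vp → Option Vp → ℝ) : List (Finset Vp) → ℝ
  | [] => 0
  | [a] => qq x a
  | a :: b :: L => qq x a + cc x a b + FF x (b :: L)

lemma VplusH_disj (a : Finset Vp) (L : List (Finset Vp)) (h : ∀ b ∈ L, Disjoint a b) :
    Disjoint a (VplusH L) := by
  induction L with
  | nil => simp [VplusH]
  | cons b L ih =>
    simp only [VplusH, List.foldr_cons, Finset.disjoint_union_right]
    exact ⟨h b (by simp), ih fun c hc => h c (by simp [hc])⟩

lemma FF_eq (x : Option Vp → Option Vp → ℝ) (L : List (Finset Vp)) (hne : L ≠ [])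
    (h : L.Pairwise Disjoint) : xH x L - ((VplusH L).card : ℝ) + 1 = FF x L := by
  induction L with
  | nil => exact absurd rfl hne
  | cons a L ih =>
    have hc : (VplusH (a :: L)).card = a.card + (VplusH L).card := by
      have := VplusH_disj a L (List.pairwise_cons.1 h).1
      exact Finset.card_union_of_disjoint this
    cases L with
    | nil => simp [FF, xH, VplusH, qq]
    | cons b L =>
      have := ih (by simp) (List.pairwise_cons.1 h).2
      rw [FF, ← this, hc]
      simp only [xH, qq, cc, List.map_cons, List.sum_cons, List.tail_cons, List.zipWith_cons_cons]
      push_cast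
      ring

lemma FF_append (x : Option Vp → Option Vp → ℝ) (A B : List (Finset Vp)) (b : Finset Vp) :
    FF x (A ++ b :: B) = FF x (A ++ [b]) + FF x (b :: B) - qq x b := by
  induction A with
  | nil => simp [FF]
  | cons a A ih =>
    cases A with
    | nil => simp [FF]; ring
    | cons a' A =>
      simp only [List.cons_append, FF] at ih ⊢
      linarith

lemma FF_reverse (x : Option Vp → Option Vp → ℝ) (hs : ∀ u v, x u v = x v u)
    (L : List (Finset Vp)) : FF x L.reverse = FF x L := by
  induction L with
  | nil => rfl
  | cons a L ih =>
    cases L with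
    | nil => rfl
    | cons b L =>
      have e : (a :: b :: L).reverse = L.reverse ++ b :: [a] := by simp
      have e' : L.reverse ++ [b] = (b :: L).reverse := by simp
      rw [e, FF_append, e', ih]
      simp only [FF, cc]
      rw [crossSum_symm x hs b a]
      ring

lemma qq_nonpos {x : Option Vp → Option Vp → ℝ} (hx : x ∈ Xsub) {S : Finset Vp}
    (h : S.Nonempty) : qq x S ≤ 0 := by
  have := hx.2.2.2.2 S h
  unfold qq; linarith

lemma qq_one {x : Option Vp → Option Vp → ℝ} {S : Finset Vp}
    (h : S.card = 1) : qq x S = 0 := by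
  obtain ⟨v, rfl⟩ := Finset.card_eq_one.1 h
  have : ({v} : Finset Vp).filter (fun w => w ≠ v) = ∅ := by ext w; simp
  simp [qq, inSum, this]

lemma qcq {x : Option Vp → Option Vp → ℝ} (hx : x ∈ Xsub) {S T : Finset Vp}
    (h : S.Nonempty) (hd : Disjoint S T) : qq x S + cc x S T + qq x T ≤ 0 := by
  have h1 := hx.2.2.2.2 (S ∪ T) (h.mono Finset.subset_union_left)
  rw [inSum_union x hx.1 hx.2.1 S T hd, Finset.card_union_of_disjoint hd] at h1
  push_cast at h1
  unfold qq cc; linarith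

lemma x_nonneg {x : Option Vp → Option Vp → ℝ} (hx : x ∈ Xsub) (u v) : 0 ≤ x u v := by
  by_cases h : u = v
  · rw [h, hx.2.1]
  · exact (hx.2.2.1 u v h).1

lemma crossSum_nonneg {x : Option Vp → Option Vp → ℝ} (hx : x ∈ Xsub) (S T : Finset Vp) :
    0 ≤ crossSum x S T :=
  Finset.sum_nonneg fun _ _ => Finset.sum_nonneg fun _ _ => x_nonneg hx _ _

lemma three {x : Option Vp → Option Vp → ℝ} (hx : x ∈ Xsub) {S T R : Finset Vp}
    (h : S.Nonempty) (h1 : Disjoint S T) (h2 : Disjoint S R) (h3 : Disjoint T R) :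
    FF x [S, T, R] ≤ 0 := by
  have hd : Disjoint S (T ∪ R) := Finset.disjoint_union_right.2 ⟨h1, h2⟩
  have h4 := hx.2.2.2.2 (S ∪ (T ∪ R)) (h.mono Finset.subset_union_left)
  rw [inSum_union x hx.1 hx.2.1 _ _ hd, inSum_union x hx.1 hx.2.1 _ _ h3,
    Finset.card_union_of_disjoint hd, Finset.card_union_of_disjoint h3] at h4
  have h5 : crossSum x S (T ∪ R) = crossSum x S T + crossSum x S R := by
    unfold crossSum
    simp only [Finset.sum_union h3, Finset.sum_add_distrib]
  have := crossSum_nonneg hx S R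
  push_cast at h4
  simp only [FF, qq, cc]; linarith

lemma deg {x : Option Vp → Option Vp → ℝ} (hx : x ∈ Xsub) {S T R : Finset Vp}
    (hT : T.card = 1) (h1 : Disjoint S T) (h2 : Disjoint S R) (h3 : Disjoint T R) :
    cc x S T + cc x T R ≤ 0 := by
  obtain ⟨v, rfl⟩ := Finset.card_eq_one.1 hT
  have hdeg := hx.2.2.2.1 v
  have e : crossSum x S {v} + crossSum x {v} R
      = ∑ u ∈ (S ∪ R).map Function.Embedding.some, x u (some v) := by
    rw [crossSum_symm x hx.1 {v} R]
    simp [crossSum, Finset.sum_union h2]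
  have le : ∑ u ∈ (S ∪ R).map Function.Embedding.some, x u (some v) ≤ degCust x v := by
    unfold degCust
    refine Finset.sum_le_sum_of_subset_of_nonneg ?_ fun _ _ _ => x_nonneg hx _ _
    intro u hu
    simp only [Finset.mem_map, Finset.mem_union, Function.Embedding.some_apply] at hu
    obtain ⟨w, hw, rfl⟩ := hu
    simp only [Finset.mem_filter, Finset.mem_univ, true_and, ne_eq, Option.some.injEq]
    rintro rfl
    rcases hw with hw | hw
    · exact Finset.disjoint_left.1 h1 hw (by simp)
    · exact Finset.disjoint_left.1 h3 (by simp) hw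
  unfold cc; linarith

lemma suffix_le {x : Option Vp → Option Vp → ℝ} (hx : x ∈ Xsub) :
    ∀ (n : ℕ) (b : Finset Vp) (Q : List (Finset Vp)), Q.length ≤ n → Q ≠ [] →
      IsPartialRoute (b :: Q) →
      FF x (b :: Q) - qq x b + qq x ((b :: Q).getD (Q.length - 1) ∅) ≤ 0 := by
  intro n
  induction n with
  | zero => intro b Q h h'; simp at h; exact absurd h h'
  | succ n ih =>
    rintro b Q hlen hQ ⟨-, hne, hdis, hch⟩
    match Q, hQ with
    | [s], _ =>
      have := qcq hx (S := b) (T := s) (hne b (by simp)) (by simpa using hdis)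
      simp [FF]; linarith
    | s :: t :: R, _ =>
      have hdis' := hdis
      simp only [List.pairwise_cons, List.mem_cons, forall_eq_or_imp] at hdis'
      obtain ⟨⟨bs, bt, -⟩, ⟨st, -⟩, -⟩ := hdis'
      have hch' : (s :: t :: R).IsChain (fun S T => S.card = 1 ∨ T.card = 1) := hch.tail
      have hch'' : (t :: R).IsChain (fun S T => S.card = 1 ∨ T.card = 1) := hch'.tail
      have hbs : b.card = 1 ∨ s.card = 1 := (List.isChain_cons_cons.1 hch).1
      have p1 : IsPartialRoute (s :: t :: R) :=
        ⟨by simp, fun S hS => hne S (List.mem_cons_of_mem _ hS), (List.pairwise_cons.1 hdis).2, hch'⟩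
      have p2 : IsPartialRoute (t :: R) :=
        ⟨by simp, fun S hS => p1.2.1 S (List.mem_cons_of_mem _ hS),
          (List.pairwise_cons.1 p1.2.2.1).2, hch''⟩
      by_cases hs : s.card = 1
      · have hd := deg hx hs bs bt st
        have qs := qq_one (x := x) hs
        have qt := qq_nonpos hx (hne t (by simp))
        cases R with
        | nil => simp [FF]; linarith
        | cons r R =>
          have := ih t (r :: R) (by simp at hlen ⊢; omega) (by simp) p2
          simp [FF] at this ⊢
          linarith
      · have hb := hbs.resolve_right hs
        have := ih s (t :: R) (by simp at hlen ⊢; omega) (by simp) p1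
        have h2 := qcq hx (hne b (by simp)) bs
        have qb := qq_one (x := x) hb
        simp [FF] at this ⊢
        linarith

lemma PR_infix {L M : List (Finset Vp)} (h : IsPartialRoute M) (hL : L ≠ []) (hi : L <:+: M) :
    IsPartialRoute L :=
  ⟨hL, fun S hS => h.2.1 S (hi.subset hS), h.2.2.1.sublist hi.sublist, List.IsChain.infix h.2.2.2 hi⟩

lemma PR_reverse {L : List (Finset Vp)} (h : IsPartialRoute L) : IsPartialRoute L.reverse := by
  refine ⟨by simpa using h.1, fun S hS => h.2.1 S (by simpa using hS), ?_, ?_⟩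
  · rw [List.pairwise_reverse]
    exact h.2.2.1.imp fun h => h.symm
  · refine List.isChain_reverse.2 ?_
    exact List.IsChain.imp (fun _ _ h => h.symm) h.2.2.2

lemma prefix_le {x : Option Vp → Option Vp → ℝ} (hx : x ∈ Xsub)
    (b : Finset Vp) (P : List (Finset Vp)) (hP : P ≠ []) (h : IsPartialRoute (P ++ [b])) :
    FF x (P ++ [b]) - qq x b + qq x ((P ++ [b]).getD 1 ∅) ≤ 0 := by
  have e : (P ++ [b]).reverse = b :: P.reverse := by simp
  have h1 := PR_reverse h
  rw [e] at h1
  have := suffix_le hx _ b P.reverse le_rfl (by simpa using hP) h1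
  rw [← e, FF_reverse x hx.1] at this
  have hp : 0 < P.length := List.length_pos_iff.2 hP
  have e2 : (P ++ [b]).reverse.getD (P.reverse.length - 1) ∅ = (P ++ [b]).getD 1 ∅ := by
    simp only [List.getD_eq_getElem?_getD]
    rw [List.getElem?_reverse (by simp)]
    congr 2
    simp; omega
  rwa [e2] at this

lemma sum_le_sub {s t : Finset ℕ} {f : ℕ → ℝ} (h : t ⊆ s) (hf : ∀ i ∈ s, f i ≤ 0) :
    ∑ i ∈ s, f i ≤ ∑ i ∈ t, f i := by
  rw [← Finset.sum_sdiff h]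
  have := Finset.sum_nonpos (s := s \ t) (f := f) fun i hi => hf i (Finset.mem_sdiff.1 hi).1
  linarith

/-- Lemma 9 of the paper: for every contiguous sub-tuple `H'` of a partial
route `H` and every `x̄ ∈ 𝒳`, `x̄(H') − |V₊(H')| + 1 ≥ W_OF(x̄; H) − 1`. -/
theorem statement_15
    (C : ℚ) (hC : 0 < C) (d : Sc → Vp → ℚ)
    (hd : ∀ ξ v, 0 ≤ d ξ v) (hdC : ∀ ξ v, d ξ v ≤ C)
    (p : Sc → ℚ) (hp : ∀ ξ, 0 ≤ p ξ) (hps : ∑ ξ, p ξ = 1)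
    (k : ℕ) (hk : 0 < k)
    (X : Set (Option Vp → Option Vp → ℝ)) (hX : X = Xsub ∨ X = Xcvrp C p d k)
    (Hs : List (Finset Vp)) (hH : IsPartialRoute Hs)
    (Hs' : List (Finset Vp)) (hne : Hs' ≠ []) (hinf : Hs' <:+: Hs)
    (x : Option Vp → Option Vp → ℝ) (hx : x ∈ X) :
    WOF x Hs - 1 ≤ xH x Hs' - ((VplusH Hs').card : ℝ) + 1 := by
  have hx : x ∈ Xsub := by
    rcases hX with rfl | rfl
    · exact hx
    · exact hx.1
  have hH' := PR_infix hH hne hinf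
  rw [FF_eq x Hs' hne hH'.2.2.1]
  unfold WOF
  rw [FF_eq x Hs hH.1 hH.2.2.1]
  change 1 + FF x Hs + ∑ i ∈ ({2, Hs.length - 1} : Finset ℕ) ∩ Finset.Icc 1 Hs.length,
        qq x (Hs.getD (i-1) ∅) - 1 ≤ _
  have hneg : ∀ i ∈ ({2, Hs.length - 1} : Finset ℕ) ∩ Finset.Icc 1 Hs.length,
      qq x (Hs.getD (i-1) ∅) ≤ 0 := by
    intro i hi
    have hi := (Finset.mem_Icc.1 (Finset.mem_inter.1 hi).2)
    have hlt : i - 1 < Hs.length := by omega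
    rw [List.getD_eq_getElem _ _ hlt]
    exact qq_nonpos hx (hH.2.1 _ (List.getElem_mem _))
  set E := ∑ i ∈ ({2, Hs.length - 1} : Finset ℕ) ∩ Finset.Icc 1 Hs.length,
        qq x (Hs.getD (i-1) ∅) with hE
  obtain ⟨P, Q, hPQ⟩ := hinf
  have key : ∀ t : Finset ℕ, t ⊆ ({2, Hs.length - 1} : Finset ℕ) ∩ Finset.Icc 1 Hs.length →
      E ≤ ∑ i ∈ t, qq x (Hs.getD (i-1) ∅) := fun t ht => sum_le_sub ht hneg
  -- prefix
  have pre : P ≠ [] → FF x Hs - FF x (Hs' ++ Q) + qq x (Hs.getD 1 ∅) ≤ 0 := by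
    intro hP
    obtain ⟨h, T, rfl⟩ := List.exists_cons_of_ne_nil hne
    have e : Hs = P ++ h :: (T ++ Q) := by rw [← hPQ]; simp
    have := prefix_le hx h P hP (PR_infix hH (by simp) ⟨[], T ++ Q, by rw [e]; simp⟩)
    have e2 : Hs.getD 1 ∅ = (P ++ [h]).getD 1 ∅ := by
      have e3 : Hs = (P ++ [h]) ++ (T ++ Q) := by rw [e]; simp
      rw [e3, List.getD_append]
      have := List.length_pos_iff.2 hP
      simp; omega
    rw [e2]
    rw [e, FF_append]
    simp only [List.cons_append]
    linarith
  have suf : Q ≠ [] → FF x (Hs' ++ Q) - FF x Hs' + qq x (Hs.getD (Hs.length - 1 - 1) ∅) ≤ 0 := by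
    intro hQ
    obtain ⟨T, g, rfl⟩ : ∃ T g, Hs' = T ++ [g] :=
      ⟨_, _, (List.dropLast_append_getLast hne).symm⟩
    have e : Hs = (P ++ T) ++ g :: Q := by rw [← hPQ]; simp
    have := suffix_le hx _ g Q le_rfl hQ (PR_infix hH (by simp) ⟨P ++ T, [], by rw [e]; simp⟩)
    have hq := List.length_pos_iff.2 hQ
    have e2 : Hs.getD (Hs.length - 1 - 1) ∅ = (g :: Q).getD (Q.length - 1) ∅ := by
      rw [e, List.getD_append_right]
      · congr 1
        simp; omega
      · simp; omega
    rw [e2]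
    have e3 : T ++ [g] ++ Q = T ++ g :: Q := by simp
    rw [e3, FF_append]
    linarith
  have hlen : Hs.length = P.length + Hs'.length + Q.length := by rw [← hPQ]; simp [add_assoc]
  have hl' := List.length_pos_iff.2 hne
  by_cases hP : P = []
  · have eP : Hs = Hs' ++ Q := by rw [← hPQ, hP]; simp
    by_cases hQ : Q = []
    · have h8 := key ∅ (by simp)
      have e9 : Hs = Hs' := by rw [eP, hQ]; simp
      rw [Finset.sum_empty] at h8
      rw [← e9]; linarith
    · have hq := List.length_pos_iff.2 hQ
      have := key {Hs.length - 1} (by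
        intro i hi
        simp only [Finset.mem_singleton] at hi
        simp; omega)
      have h7 := suf hQ
      rw [Finset.sum_singleton] at this
      rw [← eP] at h7
      linarith
  · have hp := List.length_pos_iff.2 hP
    by_cases hQ : Q = []
    · have := key {2} (by
        intro i hi
        simp only [Finset.mem_singleton] at hi
        simp; omega)
      have := pre hP
      rw [hQ, List.append_nil] at this
      simp only [Finset.sum_singleton] at *
      norm_num at *
      linarith
    · have hq := List.length_pos_iff.2 hQ
      by_cases h3 : Hs.length = 3
      · obtain ⟨a, rfl⟩ := List.length_eq_one_iff.1 (show P.length = 1 by omega)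
        obtain ⟨b, rfl⟩ := List.length_eq_one_iff.1 (show Hs'.length = 1 by omega)
        obtain ⟨c, rfl⟩ := List.length_eq_one_iff.1 (show Q.length = 1 by omega)
        have e : Hs = [a, b, c] := by rw [← hPQ]; simp
        have := key {2} (by
          intro i hi
          simp only [Finset.mem_singleton] at hi
          simp; omega)
        have hd := hH.2.2.1
        rw [e] at hd
        simp only [List.pairwise_cons, List.mem_cons, forall_eq_or_imp] at hd
        have h5 := three hx (hH.2.1 a (by rw [e]; simp)) hd.1.1 hd.1.2.1 hd.2.1.1
        have e4 : FF x [b] = qq x b := rfl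
        rw [Finset.sum_singleton] at this
        have e6 : Hs.getD (2-1) ∅ = b := by rw [e]; rfl
        rw [e6] at this
        rw [e4]
        rw [← e] at h5
        linarith
      · have := key {2, Hs.length - 1} (by
          intro i hi
          simp only [Finset.mem_singleton, Finset.mem_insert] at hi
          simp; omega)
        rw [Finset.sum_pair (by omega)] at this
        have h6 := pre hP
        have h7 := suf hQ
        rw [show 2 - 1 = 1 from rfl] at this
        linarith


end VRPSD
end
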